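/- arXiv:1706.01146 — 6 statements merged into one kernel-verified Lean document; each statement's English description precedes it below -/
import Mathlib

section
/- Let (Ω, μ) be a σ-finite measure space, let p ∈ [1, ∞), and let (T_t)_{t ∈ [0,∞)} be a positive and contractive C₀-semigroup on L^p(Ω, μ; ℝ). Assume that (T_t) is irreducible, i.e., the only closed ideals J ⊆ L^p with T_t J ⊆ J for all t ≥ 0 are J = {0} and J = L^p. Assume there exists f₀ ∈ L^p with f₀ ≥ 0, f₀ ≠ 0 and T_t f₀ = f₀ for all t ≥ 0, and that there exist a time t₀ ≥ 0 and a nonzero positive integral operator K on L^p with K g ≤ T_{t₀} g for all g ≥ 0. Then for every f ∈ L^p the limit lim_{t→∞} T_t f exists in the norm of L^p. -/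
open MeasureTheory Filter
open scoped ENNReal NNReal

noncomputable section

/-- A bounded linear operator on `L^p` is positive if it maps a.e.-nonnegative functions
to a.e.-nonnegative functions. -/
def IsPositiveOp {Ω : Type*} [MeasurableSpace Ω] {μ : Measure Ω} {p : ℝ≥0∞} [Fact (1 ≤ p)]
    (T : Lp ℝ p μ →L[ℝ] Lp ℝ p μ) : Prop :=
  ∀ f : Lp ℝ p μ, 0 ≤ f → 0 ≤ T f

/-- A bounded linear operator on `L^p` is an integral operator if there is a
nonnegative measurable kernel `k : Ω × Ω → [0,∞)` such that for every `f ∈ L^p` the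
function `x ↦ k x y * f x` is integrable for a.e. `y` and
`(T f)(y) = ∫ k x y * f x dμ(x)` for a.e. `y`. -/
def IsIntegralOp {Ω : Type*} [MeasurableSpace Ω] {μ : Measure Ω} {p : ℝ≥0∞} [Fact (1 ≤ p)]
    (T : Lp ℝ p μ →L[ℝ] Lp ℝ p μ) : Prop :=
  ∃ k : Ω → Ω → ℝ, Measurable (Function.uncurry k) ∧ (∀ x y, 0 ≤ k x y) ∧
    ∀ f : Lp ℝ p μ,
      (∀ᵐ y ∂μ, Integrable (fun x => k x y * f x) μ) ∧
      (T f : Ω → ℝ) =ᵐ[μ] fun y => ∫ x, k x y * f x ∂μ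

/-- A closed ideal of `L^p`: a closed linear subspace containing every `g` with
`|g| ≤ |f|` for some member `f`. -/
def IsClosedIdeal {Ω : Type*} [MeasurableSpace Ω] {μ : Measure Ω} {p : ℝ≥0∞}
    [Fact (1 ≤ p)] (J : Submodule ℝ (Lp ℝ p μ)) : Prop :=
  IsClosed (J : Set (Lp ℝ p μ)) ∧ ∀ f ∈ J, ∀ g : Lp ℝ p μ, |g| ≤ |f| → g ∈ J

set_option linter.unusedSectionVars false

section BanachLattice

variable {E : Type*} [NormedAddCommGroup E] [Lattice E] [HasSolidNorm E] [IsOrderedAddMonoid E]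
  [NormedSpace ℝ E] [PosSMulMono ℝ E]

theorem abs_smul_le_smul_abs (a : ℝ) (f : E) : |a • f| ≤ |a| • |f| := by
  have key : ∀ (b : ℝ) (g : E), 0 ≤ b → |b • g| ≤ b • |g| := fun b g hb =>
    abs_le'.2 ⟨smul_le_smul_of_nonneg_left (le_abs_self g) hb, by
      rw [← smul_neg]; exact smul_le_smul_of_nonneg_left (neg_le_abs g) hb⟩
  rcases le_total 0 a with ha | ha
  · simpa [abs_of_nonneg ha] using key a f ha
  · have := key (-a) f (neg_nonneg.2 ha)
    rwa [neg_smul, abs_neg, ← abs_of_nonpos ha] at this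

theorem map_le_map_of_map_nonneg {F : Type*} [AddCommGroup F] [PartialOrder F]
    [IsOrderedAddMonoid F] [Module ℝ F] [TopologicalSpace F] {P : E →L[ℝ] F}
    (hP : ∀ f, 0 ≤ f → 0 ≤ P f) {f g : E} (h : f ≤ g) : P f ≤ P g := by
  have := hP _ (sub_nonneg.2 h)
  rwa [map_sub, sub_nonneg] at this

theorem abs_map_le_map_abs {P : E →L[ℝ] E} (hP : ∀ f, 0 ≤ f → 0 ≤ P f) (f : E) :
    |P f| ≤ P |f| :=
  abs_le'.2 ⟨map_le_map_of_map_nonneg hP (le_abs_self f), by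
    rw [← map_neg]; exact map_le_map_of_map_nonneg hP (neg_le_abs f)⟩

/-- The order ideal generated by `u`. -/
def principalOrderIdeal (u : E) : Submodule ℝ E where
  carrier := {f | ∃ c : ℝ, 0 ≤ c ∧ |f| ≤ c • u}
  zero_mem' := ⟨0, le_rfl, by simp⟩
  add_mem' := by
    rintro f g ⟨c, hc, hf⟩ ⟨d, hd, hg⟩
    exact ⟨c + d, add_nonneg hc hd, (abs_add_le f g).trans (by
      rw [add_smul]; exact add_le_add hf hg)⟩
  smul_mem' := by
    rintro a f ⟨c, hc, hf⟩
    exact ⟨|a| * c, mul_nonneg (abs_nonneg a) hc, (abs_smul_le_smul_abs a f).trans (by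
      rw [mul_smul]; exact smul_le_smul_of_nonneg_left hf (abs_nonneg a))⟩

theorem mem_topologicalClosure_of_abs_le {I : Submodule ℝ E}
    (hI : ∀ f ∈ I, ∀ g : E, |g| ≤ |f| → g ∈ I) {f g : E} (hf : f ∈ I.topologicalClosure)
    (hg : |g| ≤ |f|) : g ∈ I.topologicalClosure := by
  have hc : Continuous fun x : E => (g ⊓ |x|) ⊔ (-|x|) := by
    have : Continuous fun x : E => |x| := by
      unfold abs
      fun_prop
    fun_prop
  have hgf : (g ⊓ |f|) ⊔ (-|f|) = g := by
    rw [abs_le'] at hg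
    rw [inf_eq_left.2 hg.1, sup_eq_left]
    exact neg_le.1 hg.2
  have h1 : f ∈ (fun x : E => (g ⊓ |x|) ⊔ (-|x|)) ⁻¹' (I.topologicalClosure : Set E) := by
    have hsub : closure (I : Set E) ⊆
        (fun x : E => (g ⊓ |x|) ⊔ (-|x|)) ⁻¹' (I.topologicalClosure : Set E) := by
      refine closure_minimal (fun x hx => ?_)
        (I.isClosed_topologicalClosure.preimage hc)
      refine I.le_topologicalClosure (hI x hx _ (abs_le'.2 ⟨?_, ?_⟩))
      · exact sup_le inf_le_right ((neg_nonpos.2 (abs_nonneg x)).trans (abs_nonneg x))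
      · exact neg_le.2 le_sup_right
    exact hsub hf
  simpa only [Set.mem_preimage, hgf, SetLike.mem_coe] using h1

variable {T : ℝ≥0 → (E →L[ℝ] E)}

theorem exists_dominated_near (hpos : ∀ t f, 0 ≤ f → 0 ≤ T t f)
    (hirr : ∀ J : Submodule ℝ E, IsClosed (J : Set E) → (∀ f ∈ J, ∀ g : E, |g| ≤ |f| → g ∈ J) →
      (∀ t, ∀ f ∈ J, T t f ∈ J) → J = ⊥ ∨ J = ⊤)
    {f₀ : E} (hf₀ : 0 ≤ f₀) (hne : f₀ ≠ 0) (hfix : ∀ t, T t f₀ = f₀) (f : E) {ε : ℝ}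
    (hε : 0 < ε) : ∃ (g : E) (c : ℝ), 0 ≤ c ∧ |g| ≤ c • f₀ ∧ ‖f - g‖ < ε := by
  have hJ := hirr (principalOrderIdeal f₀).topologicalClosure
    (Submodule.isClosed_topologicalClosure _)
    (fun f hf g hg => mem_topologicalClosure_of_abs_le
      (by rintro f ⟨c, hc, hf⟩ g hg; exact ⟨c, hc, hg.trans hf⟩) hf hg)
    (fun t f hf => by
      have : closure (principalOrderIdeal f₀ : Set E) ⊆
          T t ⁻¹' ((principalOrderIdeal f₀).topologicalClosure : Set E) := by
        refine closure_minimal ?_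
          ((Submodule.isClosed_topologicalClosure _).preimage (T t).continuous)
        rintro x ⟨c, hc, hx⟩
        refine Submodule.le_topologicalClosure _ ⟨c, hc, ?_⟩
        refine (abs_map_le_map_abs (hpos t) x).trans ?_
        refine (map_le_map_of_map_nonneg (hpos t) hx).trans ?_
        rw [map_smul, hfix]
      exact this hf)
  have hmem : f₀ ∈ (principalOrderIdeal f₀).topologicalClosure :=
    Submodule.le_topologicalClosure _ ⟨1, zero_le_one, by rw [one_smul, abs_of_nonneg hf₀]⟩
  have htop : f ∈ closure (principalOrderIdeal f₀ : Set E) := by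
    rcases hJ with h | h
    · rw [h, Submodule.mem_bot] at hmem
      exact absurd hmem hne
    · have : f ∈ (principalOrderIdeal f₀).topologicalClosure := h ▸ Submodule.mem_top
      exact this
  obtain ⟨g, ⟨c, hc, hg⟩, hfg⟩ := Metric.mem_closure_iff.1 htop ε hε
  exact ⟨g, c, hc, hg, by rwa [dist_eq_norm] at hfg⟩

theorem exists_map_semigroup_ne_zero (hpos : ∀ t f, 0 ≤ f → 0 ≤ T t f)
    (hT0 : T 0 = ContinuousLinearMap.id ℝ E) (hsem : ∀ s t, T (s + t) = (T s).comp (T t))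
    (hirr : ∀ J : Submodule ℝ E, IsClosed (J : Set E) → (∀ f ∈ J, ∀ g : E, |g| ≤ |f| → g ∈ J) →
      (∀ t, ∀ f ∈ J, T t f ∈ J) → J = ⊥ ∨ J = ⊤)
    {P : E →L[ℝ] ℝ} (hP : ∀ f, 0 ≤ f → 0 ≤ P f) {u : E} (hu : 0 ≤ u) (hPu : P u ≠ 0)
    {h : E} (hh : 0 ≤ h) (hne : h ≠ 0) : ∃ r, 0 < P (T r h) := by
  by_contra! hcon
  have hcon' : ∀ r, P (T r h) = 0 := fun r => le_antisymm (hcon r) (hP _ (hpos r _ hh))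
  have habs : ∀ x y : E, |x| ≤ y → (∀ r, P (T r y) = 0) → ∀ r, P (T r |x|) = 0 :=
    fun x y hxy hy r => le_antisymm
      ((map_le_map_of_map_nonneg hP (map_le_map_of_map_nonneg (hpos r) hxy)).trans_eq (hy r))
      (hP _ (hpos r _ (abs_nonneg x)))
  let J : Submodule ℝ E :=
    { carrier := {f | ∀ r, P (T r |f|) = 0}
      zero_mem' := fun r => by simp
      add_mem' := fun {f g} hf hg => habs _ _ (abs_add_le f g) fun r => by
        rw [map_add, map_add, hf r, hg r, add_zero]
      smul_mem' := fun a f hf => habs _ _ (abs_smul_le_smul_abs a f) fun r => by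
        rw [map_smul, map_smul, hf r, smul_zero] }
  have hJ := hirr J (by
      have : (J : Set E) = ⋂ r, {f | P (T r |f|) = 0} := by
        ext f; simp [J]
      rw [this]
      refine isClosed_iInter fun r => isClosed_eq ?_ continuous_const
      have : Continuous fun x : E => |x| := by
        unfold abs
        fun_prop
      fun_prop)
    (fun f hf g hg => habs _ _ hg hf)
    (fun t f hf => habs _ _ (abs_map_le_map_abs (hpos t) f) fun r => by
      have := hf (r + t)
      rwa [hsem] at this)
  rcases hJ with hJ | hJ
  · have : h ∈ J := fun r => by rw [abs_of_nonneg hh]; exact hcon' r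
    rw [hJ, Submodule.mem_bot] at this
    exact hne this
  · have : u ∈ J := hJ ▸ Submodule.mem_top
    have := this 0
    rw [hT0, abs_of_nonneg hu] at this
    exact hPu this

/-- A monotone sequence between `0` and `f₀` converges when a functional controls the norm on
the order interval. -/
theorem exists_tendsto_of_monotone [CompleteSpace E] {f₀ : E} {Λ : E →L[ℝ] ℝ}
    (hΛ : ∀ f, 0 ≤ f → 0 ≤ Λ f)
    (hΛnorm : ∀ ε > 0, ∃ δ > 0, ∀ h, |h| ≤ f₀ → Λ |h| < δ → ‖h‖ < ε)
    {u : ℕ → E} (hu : Monotone u) (h0 : ∀ n, 0 ≤ u n) (h1 : ∀ n, u n ≤ f₀) :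
    ∃ U, Tendsto u atTop (nhds U) := by
  have hmono : Monotone fun n => Λ (u n) := fun m n hmn => map_le_map_of_map_nonneg hΛ (hu hmn)
  have hbdd : BddAbove (Set.range fun n => Λ (u n)) :=
    ⟨Λ f₀, by rintro _ ⟨n, rfl⟩; exact map_le_map_of_map_nonneg hΛ (h1 n)⟩
  have hcau := (tendsto_atTop_ciSup hmono hbdd).cauchySeq
  refine cauchySeq_tendsto_of_complete (Metric.cauchySeq_iff'.2 fun ε hε => ?_)
  obtain ⟨δ, hδ, H⟩ := hΛnorm ε hε
  obtain ⟨N, hN⟩ := Metric.cauchySeq_iff'.1 hcau δ hδ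
  refine ⟨N, fun n hn => ?_⟩
  have hnn : 0 ≤ u n - u N := sub_nonneg.2 (hu hn)
  rw [dist_eq_norm]
  refine H _ ?_ ?_
  · rw [abs_of_nonneg hnn]
    exact (sub_le_self _ (h0 N)).trans (h1 n)
  · rw [abs_of_nonneg hnn, map_sub]
    exact (le_abs_self _).trans_lt (by simpa [Real.dist_eq] using hN n hn)

theorem exists_uniform_reach [CompleteSpace E] {f₀ : E} {Λ : E →L[ℝ] ℝ}
    (hΛ : ∀ f, 0 ≤ f → 0 ≤ Λ f)
    (hΛnorm : ∀ ε > 0, ∃ δ > 0, ∀ h, |h| ≤ f₀ → Λ |h| < δ → ‖h‖ < ε)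
    {φ : ℕ → (E →L[ℝ] ℝ)} (hφ : ∀ i f, 0 ≤ f → 0 ≤ φ i f)
    (hstrict : ∀ h, 0 ≤ h → (∀ i, φ i h = 0) → h = 0) {η : ℝ} (hη : 0 < η) :
    ∃ n : ℕ, ∃ δ > 0, ∀ h, 0 ≤ h → h ≤ f₀ → η ≤ Λ h → ∃ i < n, δ ≤ φ i h := by
  by_contra! hcon
  choose h h0 h1 hΛh hφh using fun n : ℕ => hcon n ((1 / 2 : ℝ) ^ n) (by positivity)
  let V : ℕ → ℕ → E := fun n k => partialSups (fun j => h (n + j)) k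
  have hle : ∀ n k j, j ≤ k → h (n + j) ≤ V n k := fun n k j hj =>
    le_partialSups_of_le (fun j => h (n + j)) hj
  have hV0 : ∀ n k, 0 ≤ V n k := fun n k => (h0 _).trans (hle n k 0 zero_le)
  have hV1 : ∀ n k, V n k ≤ f₀ := fun n k => partialSups_le _ _ _ fun j _ => h1 _
  have hVmono : ∀ n, Monotone (V n) := fun n => (partialSups fun j => h (n + j)).monotone
  choose U hU using fun n => exists_tendsto_of_monotone hΛ hΛnorm (hVmono n) (hV0 n) (hV1 n)
  have hU0 : ∀ n, 0 ≤ U n := fun n => ge_of_tendsto' (hU n) (hV0 n)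
  have hU1 : ∀ n, U n ≤ f₀ := fun n => le_of_tendsto' (hU n) (hV1 n)
  have hhU : ∀ n, h n ≤ U n := fun n => ge_of_tendsto' (hU n) fun k => hle n k 0 zero_le
  have hUanti : Antitone U := antitone_nat_of_succ_le fun n => by
    refine le_of_tendsto_of_tendsto' (hU (n + 1)) ((tendsto_add_atTop_iff_nat 1).2 (hU n))
      fun k => partialSups_le _ _ _ fun j hj => ?_
    have := hle n (k + 1) (j + 1) (by omega)
    rwa [show n + (j + 1) = n + 1 + j by ring] at this
  have hφU : ∀ i n, i < n → φ i (U n) ≤ 2 * (1 / 2 : ℝ) ^ n := fun i n hin => by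
    refine le_of_tendsto' (((φ i).continuous.tendsto _).comp (hU n)) fun k => ?_
    have hsum : V n k ≤ ∑ j ∈ Finset.range (k + 1), h (n + j) :=
      partialSups_le _ _ _ fun j hj =>
        Finset.single_le_sum (f := fun j => h (n + j)) (fun j _ => h0 _)
          (Finset.mem_range.2 (Nat.lt_succ_of_le hj))
    calc φ i (V n k) ≤ φ i (∑ j ∈ Finset.range (k + 1), h (n + j)) :=
          map_le_map_of_map_nonneg (hφ i) hsum
      _ = ∑ j ∈ Finset.range (k + 1), φ i (h (n + j)) := map_sum _ _ _
      _ ≤ ∑ j ∈ Finset.range (k + 1), (1 / 2 : ℝ) ^ (n + j) :=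
          Finset.sum_le_sum fun j _ => (hφh (n + j) i (by omega)).le
      _ = (1 / 2 : ℝ) ^ n * ∑ j ∈ Finset.range (k + 1), (1 / 2 : ℝ) ^ j := by
          rw [Finset.mul_sum]; simp_rw [pow_add]
      _ ≤ (1 / 2 : ℝ) ^ n * 2 :=
          mul_le_mul_of_nonneg_left (sum_geometric_two_le _) (by positivity)
      _ = _ := mul_comm _ _
  obtain ⟨W, hW⟩ := exists_tendsto_of_monotone hΛ hΛnorm (u := fun n => f₀ - U n)
    (fun m n hmn => sub_le_sub_left (hUanti hmn) _) (fun n => sub_nonneg.2 (hU1 n))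
    (fun n => sub_le_self _ (hU0 n))
  have hUlim : Tendsto U atTop (nhds (f₀ - W)) := by
    simpa using hW.const_sub f₀
  have hzero : f₀ - W = 0 := by
    refine hstrict _ (ge_of_tendsto' hUlim hU0) fun i => le_antisymm ?_
      (hφ i _ (ge_of_tendsto' hUlim hU0))
    have hl : Tendsto (fun n => φ i (U n)) atTop (nhds (φ i (f₀ - W))) :=
      ((φ i).continuous.tendsto _).comp hUlim
    have hr : Tendsto (fun n : ℕ => 2 * (1 / 2 : ℝ) ^ n) atTop (nhds (2 * 0)) :=
      (tendsto_pow_atTop_nhds_zero_of_lt_one (by norm_num) (by norm_num)).const_mul 2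
    rw [mul_zero] at hr
    exact le_of_tendsto_of_tendsto hl hr
      ((eventually_gt_atTop i).mono fun n hn => hφU i n hn)
  have hΛU : η ≤ Λ (f₀ - W) :=
    ge_of_tendsto' ((Λ.continuous.tendsto _).comp hUlim) fun n =>
      (hΛh n).trans (map_le_map_of_map_nonneg hΛ (hhU n))
  rw [hzero, map_zero] at hΛU
  exact hη.not_ge hΛU

theorem exists_pos_smul_le_of_reach [CompleteSpace E] (hpos : ∀ t f, 0 ≤ f → 0 ≤ T t f)
    (hsem : ∀ s t, T (s + t) = (T s).comp (T t)) (hcont : ∀ f, Continuous fun t => T t f)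
    {f₀ : E} {Λ : E →L[ℝ] ℝ} (hΛ : ∀ f, 0 ≤ f → 0 ≤ Λ f)
    (hΛnorm : ∀ ε > 0, ∃ δ > 0, ∀ h, |h| ≤ f₀ → Λ |h| < δ → ‖h‖ < ε)
    {φ : E →L[ℝ] ℝ} (hφ : ∀ f, 0 ≤ f → 0 ≤ φ f)
    (hreach : ∀ h, 0 ≤ h → h ≠ 0 → ∃ r, 0 < φ (T r h)) {w : E} (hw : 0 ≤ w) {M : ℝ≥0}
    (hlow : ∀ s ≥ M, ∃ c > 0, ∀ f, 0 ≤ f → (c * φ f) • w ≤ T s f) {η : ℝ} (hη : 0 < η) :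
    ∃ N : ℝ≥0, ∃ d > (0 : ℝ), ∀ h, 0 ≤ h → h ≤ f₀ → η ≤ Λ h → d • w ≤ T N h := by
  have hsmul : ∀ {a b : ℝ}, a ≤ b → a • w ≤ b • w := fun {a b} hab => by
    have := smul_nonneg (sub_nonneg.2 hab) hw
    rwa [sub_smul, sub_nonneg] at this
  let r : ℕ → ℝ≥0 := TopologicalSpace.denseSeq ℝ≥0
  obtain ⟨n, δ, hδ, H⟩ := exists_uniform_reach hΛ hΛnorm (φ := fun i => φ.comp (T (r i)))
    (fun i f hf => hφ _ (hpos _ _ hf)) (fun h hh hz => by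
      by_contra hne
      obtain ⟨s, hs⟩ := hreach h hh hne
      have hopen : IsOpen {s | 0 < φ (T s h)} :=
        isOpen_lt continuous_const (φ.continuous.comp (hcont h))
      obtain ⟨s', hs', i, rfl⟩ := (TopologicalSpace.denseRange_denseSeq ℝ≥0).inter_open_nonempty
        _ hopen ⟨s, hs⟩
      exact (ne_of_gt hs') (hz i)) hη
  let N : ℝ≥0 := M + ∑ i ∈ Finset.range n, r i
  have hN : ∀ i < n, ∃ s ≥ M, N = s + r i := fun i hi =>
    ⟨M + ∑ j ∈ (Finset.range n).erase i, r j, le_self_add, by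
      rw [add_assoc, Finset.sum_erase_add _ _ (Finset.mem_range.2 hi)]⟩
  have hex : ∀ m ≤ n, ∃ c > 0, ∀ i < m, ∀ f, 0 ≤ f → (c * φ (T (r i) f)) • w ≤ T N f := by
    intro m
    induction m with
    | zero => exact fun _ => ⟨1, one_pos, fun i hi => absurd hi (Nat.not_lt_zero i)⟩
    | succ m ih =>
      intro hm
      obtain ⟨c, hc, Hc⟩ := ih (Nat.le_of_succ_le hm)
      obtain ⟨s, hs, hNs⟩ := hN m hm
      obtain ⟨c', hc', Hc'⟩ := hlow s hs
      refine ⟨min c c', lt_min hc hc', fun i hi f hf => ?_⟩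
      have h0 := hφ _ (hpos (r i) _ hf)
      rcases Nat.lt_succ_iff_lt_or_eq.1 hi with hi | rfl
      · exact (hsmul (mul_le_mul_of_nonneg_right (min_le_left _ _) h0)).trans (Hc i hi f hf)
      · refine (hsmul (mul_le_mul_of_nonneg_right (min_le_right _ _) h0)).trans ?_
        rw [hNs, hsem]
        exact Hc' _ (hpos _ _ hf)
  obtain ⟨c, hc, Hc⟩ := hex n le_rfl
  refine ⟨N, c * δ, mul_pos hc hδ, fun h h0 h1 hh => ?_⟩
  obtain ⟨i, hi, hδi⟩ := H h h0 h1 hh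
  exact (hsmul (mul_le_mul_of_nonneg_left hδi hc.le)).trans (Hc i hi h h0)

theorem tendsto_zero_of_map_eq_zero [CompleteSpace E] (hpos : ∀ t f, 0 ≤ f → 0 ≤ T t f)
    (hsem : ∀ s t, T (s + t) = (T s).comp (T t)) (hcont : ∀ f, Continuous fun t => T t f)
    {f₀ : E} (hfix : ∀ t, T t f₀ = f₀) {Λ : E →L[ℝ] ℝ} (hΛ : ∀ f, 0 ≤ f → 0 ≤ Λ f)
    (hΛT : ∀ t f, Λ (T t f) = Λ f)
    (hΛnorm : ∀ ε > 0, ∃ δ > 0, ∀ h, |h| ≤ f₀ → Λ |h| < δ → ‖h‖ < ε)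
    {φ : E →L[ℝ] ℝ} (hφ : ∀ f, 0 ≤ f → 0 ≤ φ f)
    (hreach : ∀ h, 0 ≤ h → h ≠ 0 → ∃ r, 0 < φ (T r h)) {w : E} (hw : 0 ≤ w) (hΛw : 0 < Λ w)
    {M : ℝ≥0} (hlow : ∀ s ≥ M, ∃ c > 0, ∀ f, 0 ≤ f → (c * φ f) • w ≤ T s f)
    {g : E} (hg : |g| ≤ f₀) (hΛg : Λ g = 0) : Tendsto (fun t => T t g) atTop (nhds 0) := by
  have hbd : ∀ t, |T t g| ≤ f₀ := fun t =>
    (abs_map_le_map_abs (hpos t) g).trans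
      ((map_le_map_of_map_nonneg (hpos t) hg).trans_eq (hfix t))
  have hanti : ∀ s t, Λ |T (s + t) g| ≤ Λ |T t g| := fun s t => by
    rw [← hΛT s |T t g|, hsem]
    exact map_le_map_of_map_nonneg hΛ (abs_map_le_map_abs (hpos s) _)
  have hsmall : ∀ ε > 0, ∃ t, Λ |T t g| < ε := by
    by_contra! hcon
    obtain ⟨ε, hε, hcon⟩ := hcon
    obtain ⟨N, d, hd, H⟩ := exists_pos_smul_le_of_reach hpos hsem hcont hΛ hΛnorm hφ hreach hw
      hlow (half_pos hε)
    have hstep : ∀ t, Λ |T (N + t) g| ≤ Λ |T t g| - 2 * d * Λ w := fun t => by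
      set u := T t g with hu
      have h1 : Λ u⁺ - Λ u⁻ = 0 := by
        rw [← map_sub, posPart_sub_negPart, hu, hΛT, hΛg]
      have h2 : Λ u⁺ + Λ u⁻ = Λ |u| := by
        rw [← map_add, posPart_add_negPart]
      have h3 := hcon t
      rw [← hu] at h3
      have hple : u⁺ ≤ f₀ := (le_add_of_nonneg_right (negPart_nonneg u)).trans
        ((posPart_add_negPart u).le.trans (hbd t))
      have hnle : u⁻ ≤ f₀ := (le_add_of_nonneg_left (posPart_nonneg u)).trans
        ((posPart_add_negPart u).le.trans (hbd t))
      have hp := H u⁺ (posPart_nonneg u) hple (by linarith)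
      have hn := H u⁻ (negPart_nonneg u) hnle (by linarith)
      have hTu : T (N + t) g = T N u⁺ - T N u⁻ := by
        rw [← map_sub, posPart_sub_negPart, hsem]; rfl
      have habs : |T (N + t) g| ≤ T N |u| - (2 * d) • w := by
        rw [hTu, ← posPart_add_negPart u, map_add, two_mul, add_smul]
        refine abs_le'.2 ⟨?_, ?_⟩
        · rw [← sub_nonneg]
          convert add_nonneg (sub_nonneg.2 hn) (sub_nonneg.2 hn) using 1
          abel
        · rw [← sub_nonneg]
          convert add_nonneg (sub_nonneg.2 hp) (sub_nonneg.2 hp) using 1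
          abel
      refine (map_le_map_of_map_nonneg hΛ habs).trans_eq ?_
      rw [map_sub, hΛT, map_smul, smul_eq_mul]
    have hiter : ∀ k : ℕ, Λ |T (k • N) g| ≤ Λ |T 0 g| - k * (2 * d * Λ w) := fun k => by
      induction k with
      | zero => simp
      | succ k ih =>
        rw [add_smul, one_smul, add_comm (k • N)]
        push_cast
        linarith [hstep (k • N)]
    obtain ⟨k, hk⟩ := exists_nat_gt (Λ |T 0 g| / (2 * d * Λ w))
    rw [div_lt_iff₀ (by positivity)] at hk
    linarith [hiter k, hΛ _ (abs_nonneg (T (k • N) g))]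
  refine Metric.tendsto_atTop.2 fun ε hε => ?_
  obtain ⟨δ, hδ, H⟩ := hΛnorm ε hε
  obtain ⟨t, ht⟩ := hsmall δ hδ
  refine ⟨t, fun s hs => ?_⟩
  rw [dist_zero_right]
  refine H _ (hbd s) (lt_of_le_of_lt ?_ ht)
  have := hanti (s - t) t
  rwa [tsub_add_cancel_of_le hs] at this

/-- A positive contractive semigroup with a faithful invariant functional that eventually
dominates positive multiples of a single rank-one operator converges strongly. -/
theorem exists_tendsto_of_rankOne_le [CompleteSpace E] (hpos : ∀ t f, 0 ≤ f → 0 ≤ T t f)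
    (hcontr : ∀ t f, ‖T t f‖ ≤ ‖f‖)
    (hsem : ∀ s t, T (s + t) = (T s).comp (T t)) (hcont : ∀ f, Continuous fun t => T t f)
    {f₀ : E} (hf₀ : 0 ≤ f₀) (hfix : ∀ t, T t f₀ = f₀)
    (hdense : ∀ (f : E) (ε : ℝ), 0 < ε → ∃ (g : E) (c : ℝ), 0 ≤ c ∧ |g| ≤ c • f₀ ∧ ‖f - g‖ < ε)
    {Λ : E →L[ℝ] ℝ} (hΛ : ∀ f, 0 ≤ f → 0 ≤ Λ f) (hΛf₀ : 0 < Λ f₀)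
    (hΛT : ∀ t f, Λ (T t f) = Λ f)
    (hΛnorm : ∀ ε > 0, ∃ δ > 0, ∀ h, |h| ≤ f₀ → Λ |h| < δ → ‖h‖ < ε)
    {φ : E →L[ℝ] ℝ} (hφ : ∀ f, 0 ≤ f → 0 ≤ φ f)
    (hreach : ∀ h, 0 ≤ h → h ≠ 0 → ∃ r, 0 < φ (T r h)) {w : E} (hw : 0 ≤ w) (hΛw : 0 < Λ w)
    {M : ℝ≥0} (hlow : ∀ s ≥ M, ∃ c > 0, ∀ f, 0 ≤ f → (c * φ f) • w ≤ T s f) (f : E) :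
    Tendsto (fun t => T t f) atTop (nhds ((Λ f / Λ f₀) • f₀)) := by
  have hdom : ∀ g : E, ∀ c : ℝ, 0 ≤ c → |g| ≤ c • f₀ →
      Tendsto (fun t => T t g) atTop (nhds ((Λ g / Λ f₀) • f₀)) := fun g c hc hg => by
    set a := Λ g / Λ f₀ with ha
    set b := c + |a| + 1 with hb
    have hb0 : 0 < b := by positivity
    have hga : |g - a • f₀| ≤ b • f₀ := by
      calc |g - a • f₀| ≤ |g| + |a • f₀| := by
            rw [sub_eq_add_neg, ← abs_neg (a • f₀)]
            exact abs_add_le _ _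
        _ ≤ c • f₀ + |a| • f₀ := add_le_add hg
            ((abs_smul_le_smul_abs a f₀).trans_eq (by rw [abs_of_nonneg hf₀]))
        _ ≤ c • f₀ + |a| • f₀ + (1 : ℝ) • f₀ := le_add_of_nonneg_right (by rwa [one_smul])
        _ = b • f₀ := by rw [hb, add_smul, add_smul]
    have hlim := tendsto_zero_of_map_eq_zero hpos hsem hcont hfix hΛ hΛT hΛnorm hφ hreach hw hΛw
      hlow (g := b⁻¹ • (g - a • f₀)) (by
        refine (abs_smul_le_smul_abs _ _).trans ?_
        rw [abs_of_pos (inv_pos.2 hb0)]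
        refine (smul_le_smul_of_nonneg_left hga (inv_pos.2 hb0).le).trans_eq ?_
        rw [smul_smul, inv_mul_cancel₀ hb0.ne', one_smul]) (by
        rw [map_smul, map_sub, map_smul, smul_eq_mul, smul_eq_mul, ha, div_mul_cancel₀ _ hΛf₀.ne',
          sub_self, mul_zero])
    have := (hlim.const_smul b).add_const (a • f₀)
    simp only [map_smul, map_sub, hfix, smul_smul, mul_inv_cancel₀ hb0.ne', one_smul,
      sub_add_cancel, smul_zero, zero_add] at this
    exact this
  have hQ : Continuous fun f : E => (Λ f / Λ f₀) • f₀ := by fun_prop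
  refine Metric.tendsto_atTop.2 fun ε hε => ?_
  obtain ⟨δ, hδ, Hδ⟩ := Metric.continuous_iff.1 hQ f (ε / 3) (by positivity)
  obtain ⟨g, c, hc, hg, hfg⟩ := hdense f (min δ (ε / 3)) (by positivity)
  obtain ⟨N, hN⟩ := Metric.tendsto_atTop.1 (hdom g c hc hg) (ε / 3) (by positivity)
  refine ⟨N, fun t ht => ?_⟩
  have h1 : dist (T t f) (T t g) < ε / 3 := by
    rw [dist_eq_norm, ← map_sub]
    exact (hcontr t _).trans_lt (hfg.trans_le (min_le_right _ _))
  have h2 := hN t ht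
  have h3 := Hδ g (by
    rw [dist_comm, dist_eq_norm]; exact hfg.trans_le (min_le_left _ _))
  calc _ ≤ dist (T t f) (T t g) + dist (T t g) ((Λ g / Λ f₀) • f₀) +
        dist ((Λ g / Λ f₀) • f₀) ((Λ f / Λ f₀) • f₀) := dist_triangle4 _ _ _ _
    _ < ε / 3 + ε / 3 + ε / 3 := by gcongr
    _ = ε := by ring

/-- Lower bounds by a rank-one operator on a time interval propagate to all large times. -/
theorem exists_forall_rankOne_le (hpos : ∀ t f, 0 ≤ f → 0 ≤ T t f)
    (hsem : ∀ s t, T (s + t) = (T s).comp (T t))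
    {φ : E →L[ℝ] ℝ} (hφ : ∀ f, 0 ≤ f → 0 ≤ φ f) {w : E} (hw : 0 ≤ w) {q : ℝ≥0} (hq : 0 < φ (T q w))
    {a b : ℝ≥0} (hab : a < b) {c : ℝ} (hc : 0 < c)
    (hlow : ∀ s, a < s → s < b → ∀ f, 0 ≤ f → (c * φ f) • w ≤ T s f) :
    ∃ M : ℝ≥0, ∀ s ≥ M, ∃ c > 0, ∀ f, 0 ≤ f → (c * φ f) • w ≤ T s f := by
  have hiter : ∀ n : ℕ, ∀ s, a < s → s < b → ∃ c > 0, ∀ f, 0 ≤ f →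
      (c * φ f) • w ≤ T (s + n • (q + s)) f := fun n s hs hs' => by
    induction n with
    | zero => exact ⟨c, hc, fun f hf => by simpa using hlow s hs hs' f hf⟩
    | succ n ih =>
      obtain ⟨c', hc', H⟩ := ih
      refine ⟨c * φ (T q w) * c', by positivity, fun f hf => ?_⟩
      rw [show s + (n + 1) • (q + s) = s + (q + (s + n • (q + s))) by
        rw [add_smul, one_smul]; abel, hsem, hsem]
      have hf' := hpos q _ (hpos (s + n • (q + s)) f hf)
      refine le_trans ?_ (hlow s hs hs' _ hf')
      have h2 := map_le_map_of_map_nonneg hφ (map_le_map_of_map_nonneg (hpos q) (H f hf))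
      rw [map_smul, map_smul, smul_eq_mul] at h2
      rw [← sub_nonneg, ← sub_smul]
      refine smul_nonneg (sub_nonneg.2 ?_) hw
      calc c * φ (T q w) * c' * φ f = c * (c' * φ f * φ (T q w)) := by ring
        _ ≤ _ := mul_le_mul_of_nonneg_left h2 hc.le
  have hab' : (a : ℝ) < b := hab
  have ha0 : (0 : ℝ) ≤ a := a.2
  have hq0 : (0 : ℝ) ≤ q := q.2
  obtain ⟨m, ham, hmb⟩ := exists_between hab'
  have hmq : 0 < m + q := by linarith
  have hbm : 0 < b - m := by linarith
  refine ⟨((m + q) * (2 + (m + q) / (b - m))).toNNReal, fun s hs => ?_⟩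
  have hs' : (m + q) * (2 + (m + q) / (b - m)) ≤ s := Real.toNNReal_le_iff_le_coe.1 hs
  have hs0 : (2 + (m + q) / (b - m)) ≤ (s + q) / (m + q) := by
    rw [le_div_iff₀ hmq]; linarith
  have hdiv : 0 ≤ (m + q) / (b - m) := by positivity
  have hfl := Nat.floor_le (show 0 ≤ (s + q) / (m + q) by linarith)
  have hfl' := Nat.lt_floor_add_one ((s + q) / (m + q))
  obtain ⟨n, hn⟩ : ∃ n, ⌊((s : ℝ) + q) / (m + q)⌋₊ = n + 1 :=
    ⟨⌊((s : ℝ) + q) / (m + q)⌋₊ - 1, by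
      have : 1 ≤ ⌊((s : ℝ) + q) / (m + q)⌋₊ := Nat.le_floor (by push_cast; linarith)
      omega⟩
  rw [hn] at hfl hfl'
  push_cast at hfl hfl'
  have hn1 : (m + q) ≤ (b - m) * (n + 1) := by
    rw [← div_le_iff₀' hbm]; linarith
  rw [le_div_iff₀ hmq] at hfl
  rw [div_lt_iff₀ hmq] at hfl'
  have hn0 : (0 : ℝ) < n + 1 := by positivity
  have h1 : a < ((s : ℝ) - n * q) / (n + 1) := by
    rw [lt_div_iff₀ hn0]; nlinarith
  have h2 : ((s : ℝ) - n * q) / (n + 1) < b := by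
    rw [div_lt_iff₀ hn0]; nlinarith
  obtain ⟨σ, hσ⟩ : ∃ σ : ℝ≥0, (σ : ℝ) = ((s : ℝ) - n * q) / (n + 1) :=
    ⟨⟨_, ha0.trans h1.le⟩, rfl⟩
  have hsσ : s = σ + n • (q + σ) := by
    rw [← NNReal.coe_inj]
    push_cast
    rw [nsmul_eq_mul, hσ]
    field_simp
    ring
  rw [hsσ]
  exact hiter n σ (by rw [← NNReal.coe_lt_coe, hσ]; exact h1)
    (by rw [← NNReal.coe_lt_coe, hσ]; exact h2)

end BanachLattice

section Sections

variable {α β : Type*} [MeasurableSpace α] [MeasurableSpace β]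

/-- The sections of a measurable set form a separable family for the measure of the symmetric
difference. -/
theorem exists_seq_measure_section_symmDiff_lt (ν : Measure β) [IsFiniteMeasure ν]
    {G : Set (α × β)} (hG : MeasurableSet G) : ∀ ε : ℝ≥0∞, ε ≠ 0 →
      ∃ D : ℕ → Set β, ∀ x, ∃ i, ν (symmDiff (Prod.mk x ⁻¹' G) (D i)) < ε := by
  induction G, hG using MeasurableSpace.induction_on_inter generateFrom_prod.symm isPiSystem_prod
    with
  | empty => exact fun ε hε => ⟨fun _ => ∅, fun x => ⟨0, by simpa using pos_iff_ne_zero.2 hε⟩⟩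
  | basic t ht =>
    obtain ⟨s, -, u, -, rfl⟩ := ht
    refine fun ε hε => ⟨fun i => if i = 0 then ∅ else u, fun x => ?_⟩
    by_cases hx : x ∈ s
    · exact ⟨1, by simpa [hx] using pos_iff_ne_zero.2 hε⟩
    · exact ⟨0, by simpa [hx] using pos_iff_ne_zero.2 hε⟩
  | compl t _ ih =>
    intro ε hε
    obtain ⟨D, hD⟩ := ih ε hε
    refine ⟨fun i => (D i)ᶜ, fun x => (hD x).imp fun i hi => ?_⟩
    rwa [Set.preimage_compl, compl_symmDiff_compl]
  | iUnion t hdisj htm ih =>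
    intro ε hε
    have hε2 : ε / 2 ≠ 0 := (ENNReal.half_pos hε).ne'
    obtain ⟨ε', hε', hsum⟩ := ENNReal.exists_pos_sum_of_countable' hε2 ℕ
    choose D hD using fun n => ih n (ε' n) (hε' n).ne'
    obtain ⟨e, he⟩ := exists_surjective_nat (Σ N : ℕ, Fin N → ℕ)
    refine ⟨fun j => ⋃ i : Fin (e j).1, D i ((e j).2 i), fun x => ?_⟩
    choose c hc using fun n => hD n x
    let S : ℕ → Set β := fun n => Prod.mk x ⁻¹' t n
    have hSsum : ∑' n, ν (S n) ≠ ∞ := by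
      rw [← measure_iUnion (fun i j hij => (hdisj hij).preimage _)
        (fun n => measurable_prodMk_left (htm n))]
      exact measure_ne_top _ _
    obtain ⟨N, hN⟩ := ((ENNReal.tendsto_sum_nat_add _ hSsum).eventually_lt_const
      (ENNReal.half_pos hε)).exists
    obtain ⟨j, hj⟩ := he ⟨N, fun i => c i⟩
    refine ⟨j, ?_⟩
    beta_reduce
    rw [hj]
    have hSU : Prod.mk x ⁻¹' ⋃ n, t n = ⋃ n, S n := Set.preimage_iUnion
    rw [hSU]
    have hsub : symmDiff (⋃ n, S n) (⋃ i : Fin N, D i (c i)) ⊆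
        (⋃ k, S (k + N)) ∪ ⋃ n, symmDiff (S n) (D n (c n)) := by
      intro y hy
      rcases hy with ⟨h1, h2⟩ | ⟨h1, h2⟩
      · obtain ⟨n, hn⟩ := Set.mem_iUnion.1 h1
        by_cases hnN : n < N
        · exact Or.inr (Set.mem_iUnion.2 ⟨n, Or.inl ⟨hn, fun h =>
            h2 (Set.mem_iUnion.2 ⟨⟨n, hnN⟩, h⟩)⟩⟩)
        · exact Or.inl (Set.mem_iUnion.2 ⟨n - N, by
            rwa [Nat.sub_add_cancel (not_lt.1 hnN)]⟩)
      · obtain ⟨i, hi⟩ := Set.mem_iUnion.1 h1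
        exact Or.inr (Set.mem_iUnion.2 ⟨i, Or.inr ⟨hi, fun h =>
          h2 (Set.mem_iUnion.2 ⟨(i : ℕ), h⟩)⟩⟩)
    calc _ ≤ ν (⋃ k, S (k + N)) + ν (⋃ n, symmDiff (S n) (D n (c n))) :=
          (measure_mono hsub).trans (measure_union_le _ _)
      _ ≤ ∑' k, ν (S (k + N)) + ∑' n, ε' n :=
          add_le_add (measure_iUnion_le _)
            ((measure_iUnion_le _).trans (ENNReal.tsum_le_tsum fun n => (hc n).le))
      _ < ε / 2 + ε / 2 := ENNReal.add_lt_add hN hsum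
      _ = ε := ENNReal.add_halves ε

/-- In a non-null set of parameters there is one whose section is approximated by a non-null
set of sections, to any precision. -/
theorem exists_forall_measure_section_diff_lt_ne_zero (μ : Measure α) (ν : Measure β)
    [IsFiniteMeasure ν] {G : Set (α × β)} (hG : MeasurableSet G) {X : Set α} (hX : μ X ≠ 0) :
    ∃ x₀ ∈ X, ∀ ε : ℝ≥0∞, ε ≠ 0 →
      μ {x | ν ((Prod.mk x₀ ⁻¹' G) \ (Prod.mk x ⁻¹' G)) < ε} ≠ 0 := by
  have hpos : ∀ n : ℕ, ((n : ℝ≥0∞) + 1)⁻¹ ≠ 0 := fun n =>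
    ENNReal.inv_ne_zero.2 (by finiteness)
  choose D hD using fun n : ℕ => exists_seq_measure_section_symmDiff_lt ν hG _ (hpos n)
  let C : ℕ × ℕ → Set α := fun q =>
    {x | ν (symmDiff (Prod.mk x ⁻¹' G) (D q.1 q.2)) < (q.1 + 1 : ℝ≥0∞)⁻¹}
  have hnull : μ (⋃ q ∈ {q | μ (C q) = 0}, C q) = 0 :=
    (measure_biUnion_null_iff (Set.to_countable _)).2 fun q hq => hq
  obtain ⟨x₀, hx₀, hx₀'⟩ : ∃ x₀ ∈ X, x₀ ∉ ⋃ q ∈ {q | μ (C q) = 0}, C q := by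
    by_contra! hcon
    exact hX (measure_mono_null hcon hnull)
  refine ⟨x₀, hx₀, fun ε hε => ?_⟩
  obtain ⟨n, hn⟩ := ENNReal.exists_inv_nat_lt (ENNReal.half_pos hε).ne'
  have hn' : ((n : ℝ≥0∞) + 1)⁻¹ < ε / 2 :=
    (ENNReal.inv_le_inv.2 le_self_add).trans_lt hn
  obtain ⟨i, hi⟩ := hD n x₀
  have hCi : μ (C (n, i)) ≠ 0 := fun h =>
    hx₀' (Set.mem_biUnion (x := (n, i)) h hi)
  refine fun h => hCi (measure_mono_null (fun x hx => ?_) h)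
  have hsub : (Prod.mk x₀ ⁻¹' G) \ (Prod.mk x ⁻¹' G) ⊆
      symmDiff (Prod.mk x₀ ⁻¹' G) (D n i) ∪ symmDiff (Prod.mk x ⁻¹' G) (D n i) := by
    rintro y ⟨h1, h2⟩
    by_cases hy : y ∈ D n i
    · exact Or.inr (Or.inr ⟨hy, h2⟩)
    · exact Or.inl (Or.inl ⟨h1, hy⟩)
  calc _ ≤ ν (symmDiff (Prod.mk x₀ ⁻¹' G) (D n i)) + ν (symmDiff (Prod.mk x ⁻¹' G) (D n i)) :=
        (measure_mono hsub).trans (measure_union_le _ _)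
    _ < ε / 2 + ε / 2 := ENNReal.add_lt_add (hi.trans hn') (lt_trans hx hn')
    _ = ε := ENNReal.add_halves ε

end Sections

section WeightedIntegral

variable {Ω : Type*} [MeasurableSpace Ω] {μ : Measure Ω} {p : ℝ≥0∞} [Fact (1 ≤ p)]

instance posSMulMono_Lp_real : PosSMulMono ℝ (Lp ℝ p μ) where
  smul_le_smul_of_nonneg_left a ha f g hfg := by
    rw [← Lp.coeFn_le] at hfg ⊢
    filter_upwards [hfg, Lp.coeFn_smul a f, Lp.coeFn_smul a g] with x hx h1 h2
    rw [h1, h2]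
    exact mul_le_mul_of_nonneg_left hx ha

theorem one_le_toReal_exponent (hp : p ≠ ∞) : 1 ≤ p.toReal := by
  simpa using ENNReal.toReal_mono hp (Fact.out : 1 ≤ p)

theorem exponent_ne_zero : p ≠ 0 := (zero_lt_one.trans_le (Fact.out : 1 ≤ p)).ne'

theorem rpow_sub_one_mul_self {r a : ℝ} (hr : 1 ≤ r) (ha : 0 ≤ a) : a ^ (r - 1) * a = a ^ r := by
  rw [← Real.rpow_add_one' ha (by linarith), sub_add_cancel]

theorem rpow_sub_one_mul_le_add {r a b : ℝ} (hr : 1 ≤ r) (ha : 0 ≤ a) (hb : 0 ≤ b) :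
    a ^ (r - 1) * b ≤ a ^ r + b ^ r := by
  have h0 : 0 ≤ r - 1 := by linarith
  have h1 := Real.rpow_nonneg ha r
  have h2 := Real.rpow_nonneg hb r
  rcases le_total a b with h | h
  · calc a ^ (r - 1) * b ≤ b ^ (r - 1) * b := by gcongr
      _ = b ^ r := rpow_sub_one_mul_self hr hb
      _ ≤ _ := by linarith
  · calc a ^ (r - 1) * b ≤ a ^ (r - 1) * a := by gcongr
      _ = a ^ r := rpow_sub_one_mul_self hr ha
      _ ≤ _ := by linarith

/-- The graph of `x ↦ x ^ r` lies above its tangent lines. -/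
theorem rpow_add_mul_rpow_sub_one_mul_sub_le {r a b : ℝ} (hr : 1 ≤ r) (ha : 0 < a) (hb : 0 ≤ b) :
    a ^ r + r * (a ^ (r - 1) * (b - a)) ≤ b ^ r := by
  have h := one_add_mul_self_le_rpow_one_add (s := b / a - 1)
    (by linarith [div_nonneg hb ha.le]) hr
  rw [add_sub_cancel, Real.div_rpow hb ha.le, le_div_iff₀ (Real.rpow_pos_of_pos ha r)] at h
  refine le_of_eq_of_le ?_ h
  rw [← rpow_sub_one_mul_self hr ha.le]
  field_simp

theorem integrable_abs_rpow (hp : p ≠ ∞) (f : Lp ℝ p μ) :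
    Integrable (fun x => |f x| ^ p.toReal) μ :=
  (Lp.memLp f).integrable_norm_rpow exponent_ne_zero hp

theorem integral_abs_rpow (hp : p ≠ ∞) (f : Lp ℝ p μ) :
    ∫ x, |f x| ^ p.toReal ∂μ = ‖f‖ ^ p.toReal := by
  have h0 : 0 ≤ ∫ x, |f x| ^ p.toReal ∂μ := integral_nonneg fun x => by positivity
  have hr := one_le_toReal_exponent hp
  rw [Lp.norm_def, (Lp.memLp f).eLpNorm_eq_integral_rpow_norm exponent_ne_zero hp,
    ENNReal.toReal_ofReal (by positivity)]
  exact (Real.rpow_inv_rpow h0 (by linarith)).symm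

theorem integrable_abs_rpow_mul (hp : p ≠ ∞) (u f : Lp ℝ p μ) :
    Integrable (fun x => |u x| ^ (p.toReal - 1) * f x) μ := by
  refine ((integrable_abs_rpow hp u).add (integrable_abs_rpow hp f)).mono' ?_ ?_
  · exact (((Lp.stronglyMeasurable u).measurable.abs.pow_const _).mul
      (Lp.stronglyMeasurable f).measurable).aestronglyMeasurable
  · refine ae_of_all _ fun x => ?_
    rw [norm_mul, Real.norm_eq_abs, Real.norm_eq_abs, abs_of_nonneg (by positivity)]
    exact rpow_sub_one_mul_le_add (one_le_toReal_exponent hp) (abs_nonneg _) (abs_nonneg _)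

/-- The functional `f ↦ ∫ x in A, |u x| ^ (p - 1) * f x ∂μ` on `L^p`. -/
def weightedIntegral (hp : p ≠ ∞) (u : Lp ℝ p μ) (A : Set Ω) : Lp ℝ p μ →L[ℝ] ℝ :=
  LinearMap.mkContinuousOfExistsBound
    { toFun := fun f => ∫ x in A, |u x| ^ (p.toReal - 1) * f x ∂μ
      map_add' := fun f g => by
        rw [← integral_add (integrable_abs_rpow_mul hp u f).integrableOn
          (integrable_abs_rpow_mul hp u g).integrableOn]
        refine integral_congr_ae (ae_restrict_of_ae ?_)
        filter_upwards [Lp.coeFn_add f g] with x hx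
        rw [hx, Pi.add_apply, mul_add]
      map_smul' := fun c f => by
        rw [RingHom.id_apply, smul_eq_mul, ← integral_const_mul]
        refine integral_congr_ae (ae_restrict_of_ae ?_)
        filter_upwards [Lp.coeFn_smul c f] with x hx
        rw [hx, Pi.smul_apply, smul_eq_mul, mul_left_comm] }
    (LinearMap.bound_of_ball_bound one_pos (‖u‖ ^ p.toReal + 1) _ fun f hf => by
      have hr := one_le_toReal_exponent hp
      have hf1 : ‖f‖ ^ p.toReal ≤ 1 :=
        Real.rpow_le_one (norm_nonneg f) (mem_ball_zero_iff.1 hf).le (by linarith)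
      calc ‖∫ x in A, |u x| ^ (p.toReal - 1) * f x ∂μ‖
          ≤ ∫ x in A, ‖|u x| ^ (p.toReal - 1) * f x‖ ∂μ := norm_integral_le_integral_norm _
        _ ≤ ∫ x, ‖|u x| ^ (p.toReal - 1) * f x‖ ∂μ :=
          setIntegral_le_integral (integrable_abs_rpow_mul hp u f).norm
            (ae_of_all _ fun x => norm_nonneg _)
        _ ≤ ∫ x, (|u x| ^ p.toReal + |f x| ^ p.toReal) ∂μ := by
          refine integral_mono (integrable_abs_rpow_mul hp u f).norm
            ((integrable_abs_rpow hp u).add (integrable_abs_rpow hp f)) fun x => ?_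
          beta_reduce
          rw [norm_mul, Real.norm_eq_abs, Real.norm_eq_abs, abs_of_nonneg (by positivity)]
          exact rpow_sub_one_mul_le_add hr (abs_nonneg _) (abs_nonneg _)
        _ = ‖u‖ ^ p.toReal + ‖f‖ ^ p.toReal := by
          rw [integral_add (integrable_abs_rpow hp u) (integrable_abs_rpow hp f),
            integral_abs_rpow hp, integral_abs_rpow hp]
        _ ≤ ‖u‖ ^ p.toReal + 1 := by gcongr)

variable (hp : p ≠ ∞)

theorem weightedIntegral_apply (u : Lp ℝ p μ) (A : Set Ω) (f : Lp ℝ p μ) :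
    weightedIntegral hp u A f = ∫ x in A, |u x| ^ (p.toReal - 1) * f x ∂μ := rfl

theorem weightedIntegral_univ_apply (u f : Lp ℝ p μ) :
    weightedIntegral hp u Set.univ f = ∫ x, |u x| ^ (p.toReal - 1) * f x ∂μ := by
  rw [weightedIntegral_apply, setIntegral_univ]

theorem weightedIntegral_nonneg (u : Lp ℝ p μ) (A : Set Ω) (f : Lp ℝ p μ) (hf : 0 ≤ f) :
    0 ≤ weightedIntegral hp u A f := by
  refine integral_nonneg_of_ae (ae_restrict_of_ae ?_)
  filter_upwards [(Lp.coeFn_nonneg f).2 hf] with x hx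
  exact mul_nonneg (by positivity) hx

theorem weightedIntegral_mono_set (u : Lp ℝ p μ) {A B : Set Ω} (hAB : A ⊆ B) {f : Lp ℝ p μ}
    (hf : 0 ≤ f) : weightedIntegral hp u A f ≤ weightedIntegral hp u B f := by
  refine setIntegral_mono_set (integrable_abs_rpow_mul hp u f).integrableOn
    (ae_restrict_of_ae ?_) (ae_of_all _ hAB)
  filter_upwards [(Lp.coeFn_nonneg f).2 hf] with x hx
  exact mul_nonneg (by positivity) hx

theorem weightedIntegral_inter_add_diff (u : Lp ℝ p μ) (A : Set Ω) {B : Set Ω}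
    (hB : MeasurableSet B) (f : Lp ℝ p μ) :
    weightedIntegral hp u (A ∩ B) f + weightedIntegral hp u (A \ B) f =
      weightedIntegral hp u A f :=
  integral_inter_add_sdiff hB (integrable_abs_rpow_mul hp u f).integrableOn

/-- The functional with weight `u` controls the norm on the order interval `[-u, u]`. -/
theorem norm_rpow_le_weightedIntegral_abs {u h : Lp ℝ p μ} (hu : |h| ≤ u) :
    ‖h‖ ^ p.toReal ≤ weightedIntegral hp u Set.univ |h| := by
  have hr := one_le_toReal_exponent hp
  rw [← integral_abs_rpow hp, weightedIntegral_univ_apply]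
  refine integral_mono_ae (integrable_abs_rpow hp h) (integrable_abs_rpow_mul hp u |h|) ?_
  filter_upwards [(Lp.coeFn_le _ _).2 hu, Lp.coeFn_abs h] with x hx h1
  rw [h1] at hx ⊢
  rw [← rpow_sub_one_mul_self hr (abs_nonneg (h x))]
  have : |h x| ≤ |u x| := hx.trans (le_abs_self _)
  have h0 : 0 ≤ p.toReal - 1 := by linarith
  gcongr

/-- The functional with weight `u` is a subgradient of `‖·‖ ^ p / p` at `u`. -/
theorem norm_rpow_add_weightedIntegral_le {u v : Lp ℝ p μ} (hu : ∀ᵐ x ∂μ, 0 < u x)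
    (hv : 0 ≤ v) :
    ‖u‖ ^ p.toReal + p.toReal * weightedIntegral hp u Set.univ (v - u) ≤ ‖v‖ ^ p.toReal := by
  have hr := one_le_toReal_exponent hp
  rw [← integral_abs_rpow hp, ← integral_abs_rpow hp, weightedIntegral_univ_apply,
    ← integral_const_mul, ← integral_add (integrable_abs_rpow hp u)
      ((integrable_abs_rpow_mul hp u _).const_mul _)]
  refine integral_mono_ae ((integrable_abs_rpow hp u).add
      ((integrable_abs_rpow_mul hp u _).const_mul _)) (integrable_abs_rpow hp v) ?_
  filter_upwards [hu, (Lp.coeFn_nonneg v).2 hv, Lp.coeFn_sub v u] with x hux hvx h1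
  rw [Pi.zero_apply] at hvx
  rw [h1, Pi.sub_apply, abs_of_pos hux, abs_of_nonneg hvx]
  exact rpow_add_mul_rpow_sub_one_mul_sub_le hr hux hvx

/-- An element generating a dense ideal is almost everywhere positive. -/
theorem ae_pos_of_dense_dominated [SigmaFinite μ] {f₀ : Lp ℝ p μ}
    (hdense : ∀ (f : Lp ℝ p μ) (ε : ℝ), 0 < ε → ∃ g, ∃ c : ℝ,
      0 ≤ c ∧ |g| ≤ c • f₀ ∧ ‖f - g‖ < ε) :
    ∀ᵐ x ∂μ, 0 < f₀ x := by
  by_contra hcon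
  have hZ : MeasurableSet {x | ¬ 0 < f₀ x} :=
    (measurableSet_lt measurable_const (Lp.stronglyMeasurable f₀).measurable).compl
  obtain ⟨Z, hZm, hZsub, hZ0, hZfin⟩ :=
    Measure.exists_subset_measure_lt_top hZ (pos_iff_ne_zero.2 fun h => hcon h)
  let h : Lp ℝ p μ := indicatorConstLp p hZm hZfin.ne (1 : ℝ)
  have hh0 : h ≠ 0 := by
    intro h0
    rw [Lp.eq_zero_iff_ae_eq_zero] at h0
    refine hZ0.ne' (measure_mono_null (t := {x | ¬ h x = 0} ∪
      {x | ¬ h x = Z.indicator (fun _ => (1 : ℝ)) x}) (fun x hx => ?_)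
      (measure_union_null h0 indicatorConstLp_coeFn))
    by_cases hx0 : h x = 0
    · refine Or.inr fun h2 => ?_
      rw [hx0, Set.indicator_of_mem hx] at h2
      exact zero_ne_one h2
    · exact Or.inl hx0
  obtain ⟨g, c, hc, hg, hlt⟩ := hdense h ‖h‖ (norm_pos_iff.2 hh0)
  refine hlt.not_ge (Lp.norm_le_norm_of_ae_le ?_)
  filter_upwards [(Lp.coeFn_le _ _).2 hg, Lp.coeFn_abs g, Lp.coeFn_smul c f₀, Lp.coeFn_sub h g,
    indicatorConstLp_coeFn (p := p) (hs := hZm) (hμs := hZfin.ne) (c := (1 : ℝ))]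
    with x h1 h2 h3 h4 h5
  by_cases hx : x ∈ Z
  · have hgx : g x = 0 := by
      rw [h2, h3, Pi.smul_apply, smul_eq_mul] at h1
      exact abs_nonpos_iff.1 (h1.trans (mul_nonpos_of_nonneg_of_nonpos hc
        (not_lt.1 (hZsub hx))))
    rw [h4, Pi.sub_apply, hgx, sub_zero]
  · have : h x = 0 := by rw [h5, Set.indicator_of_notMem hx]
    rw [this, norm_zero]
    exact norm_nonneg _

theorem weightedIntegral_map_le_of_abs_le {S : Lp ℝ p μ →L[ℝ] Lp ℝ p μ}
    (hS : ∀ f, 0 ≤ f → 0 ≤ S f) (hcontr : ∀ f, ‖S f‖ ≤ ‖f‖) {f₀ : Lp ℝ p μ}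
    (h0 : ∀ᵐ x ∂μ, 0 < f₀ x) (hfix : S f₀ = f₀) {f : Lp ℝ p μ} (hf : |f| ≤ f₀) :
    weightedIntegral hp f₀ Set.univ (S f) ≤ weightedIntegral hp f₀ Set.univ f := by
  have hr := one_le_toReal_exponent hp
  have hr0 : 0 ≤ p.toReal - 1 := by linarith
  let ε : ℕ → ℝ := fun n => 1 / ((n : ℝ) + 1 + 1)
  have hε0 : ∀ n, 0 < ε n := fun n => by positivity
  have hε1 : ∀ n, ε n < 1 := fun n => by
    rw [div_lt_one (by positivity)]
    linarith [n.cast_nonneg (α := ℝ)]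
  have hεt : Tendsto ε atTop (nhds 0) := by
    refine ((tendsto_add_atTop_iff_nat 1).2
      (tendsto_one_div_add_atTop_nhds_zero_nat (𝕜 := ℝ))).congr fun n => ?_
    simp [ε]
  let u : ℕ → Lp ℝ p μ := fun n => f₀ + ε n • f
  have hu : ∀ᵐ x ∂μ, ∀ n, u n x = f₀ x + ε n * f x := by
    refine ae_all_iff.2 fun n => ?_
    filter_upwards [Lp.coeFn_add f₀ (ε n • f), Lp.coeFn_smul (ε n) f] with x h1 h2
    rw [h1, Pi.add_apply, h2, Pi.smul_apply, smul_eq_mul]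
  have hfx : ∀ᵐ x ∂μ, |f x| ≤ f₀ x := by
    filter_upwards [(Lp.coeFn_le _ _).2 hf, Lp.coeFn_abs f] with x h1 h2
    rwa [← h2]
  have hεf : ∀ᵐ x ∂μ, ∀ n, |ε n * f x| < f₀ x := by
    filter_upwards [h0, hfx] with x h1 h2 n
    rw [abs_mul, abs_of_pos (hε0 n)]
    nlinarith [hε0 n, hε1 n, abs_nonneg (f x)]
  have hupos : ∀ n, ∀ᵐ x ∂μ, 0 < u n x := fun n => by
    filter_upwards [hu, hεf] with x h1 h2
    rw [h1 n]
    linarith [(abs_lt.1 (h2 n)).1]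
  have hle : ∀ n, weightedIntegral hp f₀ Set.univ (S f) ≤
      weightedIntegral hp (u n) Set.univ f := by
    intro n
    have hu0 : 0 ≤ u n := (Lp.coeFn_nonneg _).1 ((hupos n).mono fun x hx => hx.le)
    have hf₀0 : 0 ≤ f₀ := (Lp.coeFn_nonneg _).1 (h0.mono fun x hx => hx.le)
    have h1 := norm_rpow_add_weightedIntegral_le hp h0 (hS _ hu0)
    have h2 := norm_rpow_add_weightedIntegral_le hp (hupos n) hf₀0
    have h3 : ‖S (u n)‖ ^ p.toReal ≤ ‖u n‖ ^ p.toReal :=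
      Real.rpow_le_rpow (norm_nonneg _) (hcontr _) (by linarith)
    have h4 : S (u n) - f₀ = ε n • S f := by simp [u, hfix]
    have h5 : f₀ - u n = -(ε n • f) := by simp [u]
    rw [h4, map_smul, smul_eq_mul] at h1
    rw [h5, map_neg, map_smul, smul_eq_mul] at h2
    have h6 : 0 < p.toReal * ε n := mul_pos (by linarith) (hε0 n)
    refine le_of_mul_le_mul_left ?_ h6
    linarith
  refine ge_of_tendsto' (x := atTop) ?_ hle
  simp_rw [weightedIntegral_univ_apply]
  refine tendsto_integral_of_dominated_convergence
    (fun x => |((2 : ℝ) • f₀ : Lp ℝ p μ) x| ^ (p.toReal - 1) * |f| x)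
    (fun n => (integrable_abs_rpow_mul hp (u n) f).aestronglyMeasurable)
    (integrable_abs_rpow_mul hp _ _) (fun n => ?_) ?_
  · filter_upwards [hu, hεf, Lp.coeFn_smul (2 : ℝ) f₀, Lp.coeFn_abs f, h0] with x h1 h2 h3 h4 h5
    rw [norm_mul, Real.norm_eq_abs, Real.norm_eq_abs, abs_of_nonneg (by positivity), h4]
    refine mul_le_mul_of_nonneg_right (Real.rpow_le_rpow (abs_nonneg _) ?_ hr0) (abs_nonneg _)
    rw [h1 n, h3, Pi.smul_apply, smul_eq_mul, abs_of_pos (mul_pos two_pos h5)]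
    refine (abs_add_le _ _).trans ?_
    rw [abs_of_pos h5]
    linarith [h2 n]
  · filter_upwards [hu] with x h1
    simp_rw [h1]
    refine Tendsto.mul_const _ (Tendsto.rpow_const ?_ (Or.inr hr0))
    simpa using (tendsto_const_nhds.add (hεt.mul_const (f x))).abs (a := f₀ x + 0 * f x)

/-- A positive contraction fixing `f₀` preserves the functional with weight `f₀`. -/
theorem weightedIntegral_map_eq {S : Lp ℝ p μ →L[ℝ] Lp ℝ p μ}
    (hS : ∀ f, 0 ≤ f → 0 ≤ S f) (hcontr : ∀ f, ‖S f‖ ≤ ‖f‖) {f₀ : Lp ℝ p μ}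
    (h0 : ∀ᵐ x ∂μ, 0 < f₀ x) (hfix : S f₀ = f₀)
    (hdense : ∀ (f : Lp ℝ p μ) (ε : ℝ), 0 < ε → ∃ g, ∃ c : ℝ,
      0 ≤ c ∧ |g| ≤ c • f₀ ∧ ‖f - g‖ < ε) (f : Lp ℝ p μ) :
    weightedIntegral hp f₀ Set.univ (S f) = weightedIntegral hp f₀ Set.univ f := by
  have key : ∀ f, |f| ≤ f₀ →
      weightedIntegral hp f₀ Set.univ (S f) = weightedIntegral hp f₀ Set.univ f := by
    intro f hf
    refine le_antisymm (weightedIntegral_map_le_of_abs_le hp hS hcontr h0 hfix hf) ?_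
    have := weightedIntegral_map_le_of_abs_le hp hS hcontr h0 hfix (f := -f) (by rwa [abs_neg])
    simp only [map_neg] at this
    exact neg_le_neg_iff.1 this
  have hf₀0 : 0 ≤ f₀ := (Lp.coeFn_nonneg _).1 (h0.mono fun x hx => hx.le)
  have hcl : IsClosed {f | weightedIntegral hp f₀ Set.univ (S f) =
      weightedIntegral hp f₀ Set.univ f} :=
    isClosed_eq ((weightedIntegral hp f₀ Set.univ).continuous.comp S.continuous)
      (weightedIntegral hp f₀ Set.univ).continuous
  refine hcl.closure_subset (Metric.mem_closure_iff.2 fun ε hε => ?_)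
  obtain ⟨g, c, hc, hg, hfg⟩ := hdense f ε hε
  refine ⟨g, ?_, by rwa [dist_eq_norm]⟩
  have hc1 : 0 < c + 1 := by linarith
  have hg' : |(c + 1)⁻¹ • g| ≤ f₀ := by
    refine (abs_smul_le_smul_abs _ _).trans ?_
    rw [abs_of_pos (inv_pos.2 hc1)]
    calc (c + 1)⁻¹ • |g| ≤ (c + 1)⁻¹ • (c • f₀ + f₀) :=
          smul_le_smul_of_nonneg_left (hg.trans (le_add_of_nonneg_right hf₀0)) (inv_pos.2 hc1).le
      _ = f₀ := by
          have hsum : c • f₀ + f₀ = (c + 1) • f₀ := by rw [add_smul, one_smul]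
          rw [hsum, smul_smul, inv_mul_cancel₀ hc1.ne', one_smul]
  have h := key _ hg'
  simp only [map_smul] at h
  exact smul_right_injective _ (inv_ne_zero hc1.ne') h

end WeightedIntegral

section Kernel

variable {Ω : Type*} [MeasurableSpace Ω] {μ : Measure Ω} {p : ℝ≥0∞} [Fact (1 ≤ p)] (hp : p ≠ ∞)

/-- The measure with density `|u| ^ (p - 1) * f` with respect to `μ`. -/
def weightedMeasure (u f : Lp ℝ p μ) : Measure Ω :=
  μ.withDensity fun x => ENNReal.ofReal (|u x| ^ (p.toReal - 1) * f x)

theorem measurable_ofReal_weight (u f : Lp ℝ p μ) :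
    Measurable fun x => ENNReal.ofReal (|u x| ^ (p.toReal - 1) * f x) :=
  (((Lp.stronglyMeasurable u).measurable.abs.pow_const _).mul
    (Lp.stronglyMeasurable f).measurable).ennreal_ofReal

theorem isFiniteMeasure_weightedMeasure (hp : p ≠ ∞) (u f : Lp ℝ p μ) :
    IsFiniteMeasure (weightedMeasure u f) :=
  isFiniteMeasure_withDensity_ofReal (integrable_abs_rpow_mul hp u f).2

theorem weightedMeasure_apply (u : Lp ℝ p μ) {f : Lp ℝ p μ} (hf : 0 ≤ f) {A : Set Ω}
    (hA : MeasurableSet A) :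
    weightedMeasure u f A = ENNReal.ofReal (weightedIntegral hp u A f) := by
  rw [weightedMeasure, withDensity_apply _ hA, weightedIntegral_apply,
    ofReal_integral_eq_lintegral_ofReal (integrable_abs_rpow_mul hp u f).integrableOn]
  refine ae_restrict_of_ae ?_
  filter_upwards [(Lp.coeFn_nonneg f).2 hf] with x hx
  exact mul_nonneg (by positivity) hx

theorem weightedMeasure_ne_zero_iff {u : Lp ℝ p μ} (hu : ∀ᵐ x ∂μ, 0 < u x) {A : Set Ω} :
    weightedMeasure u u A ≠ 0 ↔ μ A ≠ 0 := by
  refine not_congr ⟨fun h => ?_, fun h => withDensity_absolutelyContinuous _ _ h⟩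
  refine withDensity_absolutelyContinuous' (measurable_ofReal_weight u u).aemeasurable ?_ h
  filter_upwards [hu] with x hx
  rw [abs_of_pos hx]
  exact (ENNReal.ofReal_pos.2 (mul_pos (Real.rpow_pos_of_pos hx _) hx)).ne'

/-- The restriction of an `L^p` function to a measurable set. -/
def restrictLp (u : Lp ℝ p μ) {D : Set Ω} (hD : MeasurableSet D) : Lp ℝ p μ :=
  ((Lp.memLp u).indicator hD).toLp

theorem coeFn_restrictLp (u : Lp ℝ p μ) {D : Set Ω} (hD : MeasurableSet D) :
    restrictLp u hD =ᵐ[μ] D.indicator u :=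
  MemLp.coeFn_toLp _

theorem restrictLp_nonneg {u : Lp ℝ p μ} (hu : 0 ≤ u) {D : Set Ω} (hD : MeasurableSet D) :
    0 ≤ restrictLp u hD := by
  rw [← Lp.coeFn_nonneg] at hu ⊢
  filter_upwards [hu, coeFn_restrictLp u hD] with x hx h1
  rw [h1]
  exact Set.indicator_apply_nonneg fun _ => hx

theorem restrictLp_le {u : Lp ℝ p μ} (hu : 0 ≤ u) {D : Set Ω} (hD : MeasurableSet D) :
    restrictLp u hD ≤ u := by
  rw [← Lp.coeFn_nonneg] at hu
  rw [← Lp.coeFn_le]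
  filter_upwards [hu, coeFn_restrictLp u hD] with x hx h1
  rw [h1]
  exact Set.indicator_le_self' (fun _ _ => hx) x

theorem weightedIntegral_univ_restrictLp (u f : Lp ℝ p μ) {D : Set Ω} (hD : MeasurableSet D) :
    weightedIntegral hp u Set.univ (restrictLp f hD) = weightedIntegral hp u D f := by
  rw [weightedIntegral_univ_apply, weightedIntegral_apply, ← integral_indicator hD]
  refine integral_congr_ae ?_
  filter_upwards [coeFn_restrictLp f hD] with x h1
  by_cases hx : x ∈ D <;> simp [h1, hx]

/-- The functionals given by the sections of a set on which the kernel is bounded below minorize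
the operator. -/
theorem ae_weightedIntegral_section_mul_le {k : Ω → Ω → ℝ} (hk : ∀ x y, 0 ≤ k x y)
    {K : Lp ℝ p μ →L[ℝ] Lp ℝ p μ} {u f : Lp ℝ p μ} (hu : 0 ≤ u) (hf : 0 ≤ f)
    (hint : ∀ᵐ y ∂μ, Integrable (fun x => k x y * f x) μ)
    (hKf : (K f : Ω → ℝ) =ᵐ[μ] fun y => ∫ x, k x y * f x ∂μ)
    {G : Set (Ω × Ω)} (hG : MeasurableSet G) {N : ℝ} (hN : 0 ≤ N)
    (hGk : ∀ x y, (x, y) ∈ G → |u x| ^ (p.toReal - 1) * |u y| ≤ N * k x y) :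
    ∀ᵐ y ∂μ, weightedIntegral hp u ((fun x => (x, y)) ⁻¹' G) f * u y ≤ N * K f y := by
  have hf' := (Lp.coeFn_nonneg f).2 hf
  filter_upwards [hint, hKf, (Lp.coeFn_nonneg u).2 hu] with y h1 h2 h3
  rw [h2, ← integral_const_mul, weightedIntegral_apply, ← integral_mul_const]
  have hGy : MeasurableSet ((fun x => (x, y)) ⁻¹' G) := measurable_prodMk_right hG
  calc _ ≤ ∫ x in (fun x => (x, y)) ⁻¹' G, N * (k x y * f x) ∂μ := by
        refine setIntegral_mono_on_ae
          ((integrable_abs_rpow_mul hp u f).mul_const _).integrableOn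
          (h1.const_mul N).integrableOn hGy ?_
        filter_upwards [hf'] with x hx hxG
        have := mul_le_mul_of_nonneg_right (hGk x y hxG) hx
        rw [abs_of_nonneg h3] at this
        simp only [Pi.zero_apply] at hx
        linarith
    _ ≤ ∫ x, N * (k x y * f x) ∂μ := by
        refine setIntegral_le_integral (h1.const_mul N) ?_
        filter_upwards [hf'] with x hx
        exact mul_nonneg hN (mul_nonneg (hk x y) hx)

/-- If the sections `G_x`, `x ∈ A`, nearly contain the section `G_{x₀}`, then `N • K f` nearly
dominates a multiple of the restriction of `u` to `G_{x₀}`. -/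
theorem weightedIntegral_posPart_sub_le {K : Lp ℝ p μ →L[ℝ] Lp ℝ p μ}
    {u f : Lp ℝ p μ} (hu : 0 ≤ u) (hf : 0 ≤ f) (hKf0 : 0 ≤ K f)
    {G : Set (Ω × Ω)} (hG : MeasurableSet G) {N : ℝ} (hN : 0 ≤ N)
    (hKf : ∀ᵐ y ∂μ, weightedIntegral hp u ((fun x => (x, y)) ⁻¹' G) f * u y ≤ N * K f y)
    (x₀ : Ω) {η : ℝ} (hη : 0 ≤ η) {A : Set Ω} (hA : MeasurableSet A)
    (hAη : ∀ x ∈ A, weightedMeasure u u ((Prod.mk x₀ ⁻¹' G) \ (Prod.mk x ⁻¹' G)) ≤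
      ENNReal.ofReal η) :
    weightedIntegral hp u Set.univ
      ((weightedIntegral hp u A f • restrictLp u (measurable_prodMk_left (x := x₀) hG)
        - N • K f) ⊔ 0) ≤ η * weightedIntegral hp u A f := by
  set α := weightedIntegral hp u A f with hα
  have hα0 : 0 ≤ α := weightedIntegral_nonneg hp u A f hf
  set e := (α • restrictLp u (measurable_prodMk_left (x := x₀) hG) - N • K f) ⊔ 0 with he
  have he0 : 0 ≤ e := le_sup_right
  let H : Set (Ω × Ω) := (A ×ˢ (Prod.mk x₀ ⁻¹' G)) \ G
  have hH : MeasurableSet H := (hA.prod (measurable_prodMk_left hG)).diff hG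
  have hez : ∀ᵐ z ∂μ, e z ≤ weightedIntegral hp u ((fun x => (x, z)) ⁻¹' H) f * u z := by
    filter_upwards [hKf, Lp.coeFn_sup (α • restrictLp u (measurable_prodMk_left (x := x₀) hG)
      - N • K f) 0, Lp.coeFn_sub (α • restrictLp u (measurable_prodMk_left (x := x₀) hG))
      (N • K f), Lp.coeFn_smul α (restrictLp u (measurable_prodMk_left (x := x₀) hG)),
      Lp.coeFn_smul N (K f), coeFn_restrictLp u (measurable_prodMk_left (x := x₀) hG),
      Lp.coeFn_zero ℝ p μ, (Lp.coeFn_nonneg u).2 hu, (Lp.coeFn_nonneg (K f)).2 hKf0]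
      with z h1 h2 h3 h4 h5 h6 h7 h8 h9
    have hnn : 0 ≤ weightedIntegral hp u ((fun x => (x, z)) ⁻¹' H) f :=
      weightedIntegral_nonneg hp u _ f hf
    rw [Pi.zero_apply] at h8 h9
    rw [he, h2, Pi.sup_apply, h3, Pi.sub_apply, h4, h5, Pi.smul_apply, Pi.smul_apply, h6, h7,
      Pi.zero_apply, smul_eq_mul, smul_eq_mul]
    refine sup_le ?_ (mul_nonneg hnn h8)
    by_cases hz : (x₀, z) ∈ G
    · have hsec : (fun x => (x, z)) ⁻¹' H = A \ ((fun x => (x, z)) ⁻¹' G) := by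
        ext x
        simp [H, hz]
      have hsplit := weightedIntegral_inter_add_diff hp u A
        (measurable_prodMk_right (y := z) hG) f
      have hle := weightedIntegral_mono_set hp u
        (Set.inter_subset_right (s := A) (t := (fun x => (x, z)) ⁻¹' G)) hf
      rw [Set.indicator_of_mem (show z ∈ Prod.mk x₀ ⁻¹' G from hz), hsec]
      rw [← hα] at hsplit
      nlinarith
    · rw [Set.indicator_of_notMem (show z ∉ Prod.mk x₀ ⁻¹' G from hz)]
      nlinarith [mul_nonneg hnn h8, mul_nonneg hN h9]
  have := isFiniteMeasure_weightedMeasure hp u f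
  have := isFiniteMeasure_weightedMeasure hp u u
  rw [← ENNReal.ofReal_le_ofReal_iff (mul_nonneg hη hα0)]
  calc ENNReal.ofReal (weightedIntegral hp u Set.univ e)
      = ∫⁻ z, ENNReal.ofReal (|u z| ^ (p.toReal - 1) * e z) ∂μ := by
        rw [← weightedMeasure_apply hp u he0 MeasurableSet.univ, weightedMeasure,
          withDensity_apply _ MeasurableSet.univ, setLIntegral_univ]
    _ ≤ ∫⁻ z, ENNReal.ofReal (|u z| ^ (p.toReal - 1) * u z) *
          weightedMeasure u f ((fun x => (x, z)) ⁻¹' H) ∂μ := by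
        refine lintegral_mono_ae ?_
        filter_upwards [hez, (Lp.coeFn_nonneg u).2 hu] with z h1 h2
        rw [weightedMeasure_apply hp u hf (measurable_prodMk_right hH),
          ← ENNReal.ofReal_mul (mul_nonneg (by positivity) h2)]
        refine ENNReal.ofReal_le_ofReal ?_
        rw [mul_assoc, mul_comm (u z)]
        exact mul_le_mul_of_nonneg_left h1 (by positivity)
    _ = ∫⁻ z, weightedMeasure u f ((fun x => (x, z)) ⁻¹' H) ∂(weightedMeasure u u) :=
        (lintegral_withDensity_eq_lintegral_mul μ (measurable_ofReal_weight u u)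
          (measurable_measure_prodMk_right hH)).symm
    _ = ∫⁻ x, weightedMeasure u u (Prod.mk x ⁻¹' H) ∂(weightedMeasure u f) := by
        rw [← Measure.prod_apply_symm hH, Measure.prod_apply hH]
    _ ≤ ∫⁻ x, A.indicator (fun _ => ENNReal.ofReal η) x ∂(weightedMeasure u f) := by
        refine lintegral_mono fun x => ?_
        by_cases hx : x ∈ A
        · rw [Set.indicator_of_mem hx]
          refine (measure_mono fun z hz => ?_).trans (hAη x hx)
          exact ⟨hz.1.2, hz.2⟩
        · have : Prod.mk x ⁻¹' H = ∅ := by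
            ext z
            simp [H, hx]
          simp [this]
    _ = ENNReal.ofReal (η * α) := by
        rw [lintegral_indicator hA, setLIntegral_const, weightedMeasure_apply hp u hf hA,
          ENNReal.ofReal_mul hη]

/-- If the kernel is bounded below on `G`, then a positive operator `S` that does not annihilate
one section of `G` against another gives rise to a rank one minorant of `K S K`. -/
theorem smul_restrictLp_le_comp {K S : Lp ℝ p μ →L[ℝ] Lp ℝ p μ}
    (hKpos : ∀ f, 0 ≤ f → 0 ≤ K f) (hSpos : ∀ f, 0 ≤ f → 0 ≤ S f)
    {u : Lp ℝ p μ} (hu : 0 ≤ u) (hSu : S u = u)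
    (hΛS : ∀ f, weightedIntegral hp u Set.univ (S f) = weightedIntegral hp u Set.univ f)
    {G : Set (Ω × Ω)} (hG : MeasurableSet G) {N : ℝ} (hN : 0 < N)
    (hK : ∀ f, 0 ≤ f →
      ∀ᵐ y ∂μ, weightedIntegral hp u ((fun x => (x, y)) ⁻¹' G) f * u y ≤ N * K f y)
    (x₀ y₀ : Ω) {η : ℝ} (hη : 0 ≤ η)
    (hSG : 3 * η ≤ weightedIntegral hp u ((fun x => (x, y₀)) ⁻¹' G)
      (S (restrictLp u (measurable_prodMk_left (x := x₀) hG))))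
    {A B : Set Ω} (hA : MeasurableSet A) (hB : MeasurableSet B)
    (hAη : ∀ x ∈ A, weightedMeasure u u ((Prod.mk x₀ ⁻¹' G) \ (Prod.mk x ⁻¹' G)) ≤
      ENNReal.ofReal η)
    (hBη : ∀ y ∈ B, weightedMeasure u u
      (((fun x => (x, y₀)) ⁻¹' G) \ ((fun x => (x, y)) ⁻¹' G)) ≤ ENNReal.ofReal η)
    {f : Lp ℝ p μ} (hf : 0 ≤ f) :
    (η / N ^ 2 * weightedIntegral hp u A f) • restrictLp u hB ≤ K (S (K f)) := by
  have he := weightedIntegral_posPart_sub_le hp hu hf (hKpos f hf) hG hN.le (hK f hf) x₀ hη hA hAη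
  set α := weightedIntegral hp u A f with hα
  have hα0 : 0 ≤ α := weightedIntegral_nonneg hp u A f hf
  set w := restrictLp u (measurable_prodMk_left (x := x₀) hG) with hw
  set e := (α • w - N • K f) ⊔ 0 with he_def
  have he0 : 0 ≤ S e := hSpos e le_sup_right
  have hSe : α • S w - N • S (K f) ≤ S e := by
    have := map_le_map_of_map_nonneg hSpos (le_sup_left : α • w - N • K f ≤ e)
    simpa only [map_sub, map_smul] using this
  have hSw : S w ≤ u := by
    have := map_le_map_of_map_nonneg hSpos (restrictLp_le hu (measurable_prodMk_left (x := x₀) hG))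
    rwa [hSu] at this
  have hSK : 0 ≤ S (K f) := hSpos _ (hKpos f hf)
  rw [← Lp.coeFn_le]
  filter_upwards [hK _ hSK, (Lp.coeFn_nonneg u).2 hu, coeFn_restrictLp u hB,
    Lp.coeFn_smul (η / N ^ 2 * α) (restrictLp u hB), (Lp.coeFn_nonneg _).2 (hKpos _ hSK)]
    with y h1 h2 h3 h4 h5
  rw [Pi.zero_apply] at h2 h5
  rw [h4, Pi.smul_apply, h3, smul_eq_mul]
  by_cases hy : y ∈ B
  swap
  · rwa [Set.indicator_of_notMem hy, mul_zero]
  rw [Set.indicator_of_mem hy]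
  set U := (fun x => (x, y₀)) ⁻¹' G
  set V := (fun x => (x, y)) ⁻¹' G
  have hUm : MeasurableSet U := measurable_prodMk_right hG
  have hVm : MeasurableSet V := measurable_prodMk_right hG
  have hdiff : weightedIntegral hp u (U \ V) (S w) ≤ η := by
    have hle := map_le_map_of_map_nonneg (weightedIntegral_nonneg hp u (U \ V)) hSw
    refine hle.trans ?_
    have := hBη y hy
    rwa [weightedMeasure_apply hp u hu (hUm.diff hVm), ENNReal.ofReal_le_ofReal_iff hη] at this
  have hsplit := weightedIntegral_inter_add_diff hp u U hVm (S w)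
  have hD := map_le_map_of_map_nonneg (weightedIntegral_nonneg hp u (U ∩ V)) hSe
  rw [map_sub, map_smul, map_smul, smul_eq_mul, smul_eq_mul] at hD
  have hDe : weightedIntegral hp u (U ∩ V) (S e) ≤ η * α := by
    refine (weightedIntegral_mono_set hp u (Set.subset_univ _) he0).trans ?_
    rwa [hΛS]
  have hDV : weightedIntegral hp u (U ∩ V) (S (K f)) ≤ weightedIntegral hp u V (S (K f)) :=
    weightedIntegral_mono_set hp u Set.inter_subset_right hSK
  have hmain : η * α ≤ N * weightedIntegral hp u V (S (K f)) := by
    have h6 : α * (2 * η) ≤ α * weightedIntegral hp u (U ∩ V) (S w) :=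
      mul_le_mul_of_nonneg_left (by linarith) hα0
    have h7 := mul_le_mul_of_nonneg_left hDV hN.le
    linarith
  have hfin : η * α * u y ≤ N ^ 2 * K (S (K f)) y := by
    have h8 := mul_le_mul_of_nonneg_right hmain h2
    have h9 := mul_le_mul_of_nonneg_left h1 hN.le
    linarith
  rw [div_mul_eq_mul_div, div_mul_eq_mul_div, div_le_iff₀ (by positivity)]
  linarith

end Kernel

section RankOne

variable {Ω : Type*} [MeasurableSpace Ω] {μ : Measure Ω} {p : ℝ≥0∞} [Fact (1 ≤ p)] (hp : p ≠ ∞)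

theorem weightedIntegral_self_pos {u : Lp ℝ p μ} (hu : ∀ᵐ x ∂μ, 0 < u x) {A : Set Ω}
    (hA : MeasurableSet A) (hA0 : μ A ≠ 0) : 0 < weightedIntegral hp u A u := by
  have hu0 : 0 ≤ u := (Lp.coeFn_nonneg _).1 (hu.mono fun x hx => hx.le)
  have h := (weightedMeasure_ne_zero_iff hu).2 hA0
  rw [weightedMeasure_apply hp u hu0 hA] at h
  exact ENNReal.ofReal_pos.1 (pos_iff_ne_zero.2 h)

theorem restrictLp_ne_zero {u : Lp ℝ p μ} (hp : p ≠ ∞) (hu : ∀ᵐ x ∂μ, 0 < u x) {A : Set Ω}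
    (hA : MeasurableSet A) (hA0 : μ A ≠ 0) : restrictLp u hA ≠ 0 := fun h =>
  (weightedIntegral_self_pos hp hu hA hA0).ne' <| by
    rw [← weightedIntegral_univ_restrictLp hp u u hA, h, map_zero]

/-- The kernel of a nonzero integral operator is bounded below on some non-null set. -/
theorem exists_measurableSet_le_mul_kernel [SigmaFinite μ] {K : Lp ℝ p μ →L[ℝ] Lp ℝ p μ}
    (hK : K ≠ 0) {k : Ω → Ω → ℝ} (hkm : Measurable (Function.uncurry k))
    (hk : ∀ x y, 0 ≤ k x y)
    (hKk : ∀ f : Lp ℝ p μ, (K f : Ω → ℝ) =ᵐ[μ] fun y => ∫ x, k x y * f x ∂μ)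
    {b : Ω × Ω → ℝ} (hb : Measurable b) :
    ∃ G : Set (Ω × Ω), MeasurableSet G ∧ μ.prod μ G ≠ 0 ∧
      ∃ N : ℝ, 0 < N ∧ ∀ x y, (x, y) ∈ G → b (x, y) ≤ N * k x y := by
  by_contra! hcon
  have hnull : ∀ n : ℕ, μ.prod μ {z | 0 < Function.uncurry k z ∧
      b z ≤ ((n : ℝ) + 1) * Function.uncurry k z} = 0 := by
    intro n
    by_contra h0
    obtain ⟨x, y, hxy, hlt⟩ := hcon _ ((measurableSet_lt measurable_const hkm).inter
      (measurableSet_le hb (hkm.const_mul _))) h0 ((n : ℝ) + 1) (by positivity)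
    exact hlt.not_ge hxy.2
  have hk0 : ∀ᵐ z ∂(μ.prod μ), k z.1 z.2 = 0 := by
    refine measure_mono_null (fun z hz => ?_) (measure_iUnion_null hnull)
    have hz0 : 0 < k z.1 z.2 := lt_of_le_of_ne (hk _ _) (Ne.symm hz)
    obtain ⟨n, hn⟩ := exists_nat_ge (b z / k z.1 z.2)
    refine Set.mem_iUnion.2 ⟨n, hz0, ?_⟩
    rw [div_le_iff₀ hz0] at hn
    exact hn.trans (mul_le_mul_of_nonneg_right (by linarith) hz0.le)
  have hk1 : ∀ᵐ y ∂μ, ∀ᵐ x ∂μ, k x y = 0 :=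
    (Measure.ae_ae_comm (p := fun x y => k x y = 0)
      (measurableSet_eq_fun hkm measurable_const)).1
      (Measure.ae_ae_of_ae_prod hk0)
  refine hK (ContinuousLinearMap.ext fun f => ?_)
  rw [zero_apply, Lp.eq_zero_iff_ae_eq_zero]
  filter_upwards [hKk f, hk1] with y h1 h2
  rw [h1]
  refine integral_eq_zero_of_ae ?_
  filter_upwards [h2] with x hx
  simp [hx]

theorem measure_setOf_prodMk_preimage_ne_zero [SigmaFinite μ] {G : Set (Ω × Ω)}
    (hG : MeasurableSet G) (h0 : μ.prod μ G ≠ 0) :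
    μ {x | μ (Prod.mk x ⁻¹' G) ≠ 0} ≠ 0 := fun h =>
  h0 ((Measure.measure_prod_null hG).2 h)

/-- A semigroup dominating a nonzero integral operator has rank one minorants for all times in
some interval. -/
theorem exists_interval_rankOne_le [SigmaFinite μ] {T : ℝ≥0 → (Lp ℝ p μ →L[ℝ] Lp ℝ p μ)}
    (hpos : ∀ t f, 0 ≤ f → 0 ≤ T t f)
    (hT0 : T 0 = ContinuousLinearMap.id ℝ (Lp ℝ p μ))
    (hsem : ∀ s t, T (s + t) = (T s).comp (T t))
    (hcont : ∀ f : Lp ℝ p μ, Continuous fun t => T t f)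
    (hirr : ∀ J : Submodule ℝ (Lp ℝ p μ), IsClosed (J : Set (Lp ℝ p μ)) →
      (∀ f ∈ J, ∀ g : Lp ℝ p μ, |g| ≤ |f| → g ∈ J) →
      (∀ t, ∀ f ∈ J, T t f ∈ J) → J = ⊥ ∨ J = ⊤)
    {u : Lp ℝ p μ} (hu : ∀ᵐ x ∂μ, 0 < u x) (hfix : ∀ t, T t u = u)
    (hΛT : ∀ t f, weightedIntegral hp u Set.univ (T t f) = weightedIntegral hp u Set.univ f)
    {t₀ : ℝ≥0} {K : Lp ℝ p μ →L[ℝ] Lp ℝ p μ} (hKpos : ∀ f, 0 ≤ f → 0 ≤ K f)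
    (hKker : IsIntegralOp K) (hKne : K ≠ 0) (hKdom : ∀ f, 0 ≤ f → K f ≤ T t₀ f) :
    ∃ (A B : Set Ω) (hB : MeasurableSet B), MeasurableSet A ∧ μ A ≠ 0 ∧ μ B ≠ 0 ∧
      ∃ a b : ℝ≥0, a < b ∧ ∃ c : ℝ, 0 < c ∧ ∀ s, a < s → s < b → ∀ f, 0 ≤ f →
        (c * weightedIntegral hp u A f) • restrictLp u hB ≤ T s f := by
  have hu0 : 0 ≤ u := (Lp.coeFn_nonneg _).1 (hu.mono fun x hx => hx.le)
  have hum := (Lp.stronglyMeasurable u).measurable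
  obtain ⟨k, hkm, hk, hKk⟩ := hKker
  obtain ⟨G, hG, hG0, N, hN, hGk⟩ := exists_measurableSet_le_mul_kernel hKne hkm hk
    (fun f => (hKk f).2) (b := fun z => |u z.1| ^ (p.toReal - 1) * |u z.2|)
    (((hum.comp measurable_fst).abs.pow_const _).mul (hum.comp measurable_snd).abs)
  have hGs : MeasurableSet (Prod.swap ⁻¹' G) := measurable_swap hG
  have hGs0 : μ.prod μ (Prod.swap ⁻¹' G) ≠ 0 := by
    rwa [← Measure.map_apply measurable_swap hG, Measure.prod_swap]
  have := isFiniteMeasure_weightedMeasure hp u u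
  obtain ⟨x₀, hx₀, hA⟩ := exists_forall_measure_section_diff_lt_ne_zero μ (weightedMeasure u u) hG
    (measure_setOf_prodMk_preimage_ne_zero hG hG0)
  obtain ⟨y₀, hy₀, hB⟩ := exists_forall_measure_section_diff_lt_ne_zero μ (weightedMeasure u u) hGs
    (measure_setOf_prodMk_preimage_ne_zero hGs hGs0)
  have hUm : MeasurableSet (Prod.mk x₀ ⁻¹' G) := measurable_prodMk_left hG
  have hVm : MeasurableSet ((fun x => (x, y₀)) ⁻¹' G) := measurable_prodMk_right hG
  obtain ⟨q, hq⟩ := exists_map_semigroup_ne_zero hpos hT0 hsem hirr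
    (weightedIntegral_nonneg hp u ((fun x => (x, y₀)) ⁻¹' G)) hu0
    (weightedIntegral_self_pos hp hu hVm hy₀).ne' (restrictLp_nonneg hu0 hUm)
    (restrictLp_ne_zero hp hu hUm hx₀)
  set P := weightedIntegral hp u ((fun x => (x, y₀)) ⁻¹' G) with hP
  obtain ⟨η, hη, hηq⟩ : ∃ η : ℝ, 0 < η ∧ 3 * η < P (T q (restrictLp u hUm)) :=
    ⟨P (T q (restrictLp u hUm)) / 4, by positivity, by linarith⟩
  have hnhds : {s | 3 * η < P (T s (restrictLp u hUm))} ∈ nhds q :=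
    (P.continuous.comp (hcont _)).continuousAt.eventually_const_lt hηq
  obtain ⟨b, hqb, hb⟩ := exists_Ico_subset_of_mem_nhds hnhds ⟨q + 1, lt_add_one q⟩
  have hη' : ENNReal.ofReal η ≠ 0 := (ENNReal.ofReal_pos.2 hη).ne'
  have hAm : MeasurableSet {x | weightedMeasure u u ((Prod.mk x₀ ⁻¹' G) \ (Prod.mk x ⁻¹' G)) <
      ENNReal.ofReal η} :=
    measurableSet_lt (measurable_measure_prodMk_left
      ((measurable_snd hUm).diff hG)) measurable_const
  have hBm : MeasurableSet {y | weightedMeasure u u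
      ((Prod.mk y₀ ⁻¹' (Prod.swap ⁻¹' G)) \ (Prod.mk y ⁻¹' (Prod.swap ⁻¹' G))) <
      ENNReal.ofReal η} :=
    measurableSet_lt (measurable_measure_prodMk_left
      ((measurable_snd (measurable_prodMk_left hGs)).diff hGs)) measurable_const
  refine ⟨_, _, hBm, hAm, hA _ hη', hB _ hη', t₀ + q + t₀, t₀ + b + t₀, by gcongr,
    η / N ^ 2, by positivity, fun s hs1 hs2 f hf => ?_⟩
  obtain ⟨s', rfl⟩ : ∃ s', s = t₀ + s' + t₀ := by
    obtain ⟨d, rfl⟩ := exists_add_of_le hs1.le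
    exact ⟨q + d, by ring⟩
  have hqs : q < s' := by simpa using hs1
  have hsb : s' < b := by simpa using hs2
  refine (smul_restrictLp_le_comp hp hKpos (hpos s') hu0 (hfix s') (hΛT s') hG hN
    (fun f hf => ae_weightedIntegral_section_mul_le hp hk hu0 hf (hKk f).1 (hKk f).2 hG hN.le hGk)
    x₀ y₀ hη.le (hb ⟨hqs.le, hsb⟩).le hAm hBm (fun x hx => le_of_lt hx)
    (fun y hy => le_of_lt hy) hf).trans ?_
  rw [hsem, hsem]
  have h1 := hKpos f hf
  exact (hKdom _ (hpos s' _ h1)).trans (map_le_map_of_map_nonneg (hpos t₀)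
    (map_le_map_of_map_nonneg (hpos s') (hKdom f hf)))

end RankOne

/-- An irreducible positive contractive `C₀`-semigroup on `L^p` over a σ-finite measure
space that dominates a nonzero positive integral operator and has a nonzero positive
fixed point converges strongly as `t → ∞`. -/
theorem pichor_rudnicki_irreducible_convergence
    {Ω : Type*} [MeasurableSpace Ω] (μ : Measure Ω) [SigmaFinite μ]
    (p : ℝ≥0∞) [Fact (1 ≤ p)] (hp : p ≠ ∞)
    (T : ℝ≥0 → (Lp ℝ p μ →L[ℝ] Lp ℝ p μ))
    (hpos : ∀ t, IsPositiveOp (T t))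
    (hcontr : ∀ t (f : Lp ℝ p μ), ‖T t f‖ ≤ ‖f‖)
    (hT0 : T 0 = ContinuousLinearMap.id ℝ (Lp ℝ p μ))
    (hsem : ∀ s t, T (s + t) = (T s).comp (T t))
    (hcont : ∀ f : Lp ℝ p μ, Continuous fun t => T t f)
    (hirr : ∀ J : Submodule ℝ (Lp ℝ p μ), IsClosedIdeal J →
      (∀ t, ∀ f ∈ J, T t f ∈ J) → J = ⊥ ∨ J = ⊤)
    (f₀ : Lp ℝ p μ) (hf₀pos : 0 ≤ f₀) (hf₀ne : f₀ ≠ 0) (hfix : ∀ t, T t f₀ = f₀)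
    (t₀ : ℝ≥0) (K : Lp ℝ p μ →L[ℝ] Lp ℝ p μ) (hKpos : IsPositiveOp K)
    (hKker : IsIntegralOp K) (hKne : K ≠ 0)
    (hKdom : ∀ g : Lp ℝ p μ, 0 ≤ g → K g ≤ T t₀ g) :
    ∀ f : Lp ℝ p μ, ∃ g : Lp ℝ p μ, Tendsto (fun t => T t f) atTop (nhds g) := by
  have hirr' : ∀ J : Submodule ℝ (Lp ℝ p μ), IsClosed (J : Set (Lp ℝ p μ)) →
      (∀ f ∈ J, ∀ g : Lp ℝ p μ, |g| ≤ |f| → g ∈ J) →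
      (∀ t, ∀ f ∈ J, T t f ∈ J) → J = ⊥ ∨ J = ⊤ :=
    fun J hJ hJs => hirr J ⟨hJ, hJs⟩
  have hr := one_le_toReal_exponent hp
  have hdense : ∀ (f : Lp ℝ p μ) (ε : ℝ), 0 < ε → ∃ g, ∃ c : ℝ,
      0 ≤ c ∧ |g| ≤ c • f₀ ∧ ‖f - g‖ < ε :=
    fun f ε hε => exists_dominated_near hpos hirr' hf₀pos hf₀ne hfix f hε
  have hpos₀ : ∀ᵐ x ∂μ, 0 < f₀ x := ae_pos_of_dense_dominated hdense
  have hμ : μ Set.univ ≠ 0 := fun h => hf₀ne <| by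
    rw [Lp.eq_zero_iff_ae_eq_zero]
    exact measure_mono_null (Set.subset_univ _) h
  have hΛT : ∀ t f, weightedIntegral hp f₀ Set.univ (T t f) =
      weightedIntegral hp f₀ Set.univ f :=
    fun t => weightedIntegral_map_eq hp (hpos t) (hcontr t) hpos₀ (hfix t) hdense
  have hΛnorm : ∀ ε > 0, ∃ δ > 0, ∀ h : Lp ℝ p μ, |h| ≤ f₀ →
      weightedIntegral hp f₀ Set.univ |h| < δ → ‖h‖ < ε := by
    refine fun ε hε => ⟨ε ^ p.toReal, by positivity, fun h hh hlt => ?_⟩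
    exact (Real.rpow_lt_rpow_iff (norm_nonneg h) hε.le (by linarith)).1
      ((norm_rpow_le_weightedIntegral_abs hp hh).trans_lt hlt)
  obtain ⟨A, B, hB, hA, hA0, hB0, a, b, hab, c, hc, hlow⟩ := exists_interval_rankOne_le hp hpos hT0
    hsem hcont hirr' hpos₀ hfix hΛT hKpos hKker hKne hKdom
  have hreach : ∀ h : Lp ℝ p μ, 0 ≤ h → h ≠ 0 → ∃ s, 0 < weightedIntegral hp f₀ A (T s h) :=
    fun h hh hne => exists_map_semigroup_ne_zero hpos hT0 hsem hirr'
      (weightedIntegral_nonneg hp f₀ A) hf₀pos (weightedIntegral_self_pos hp hpos₀ hA hA0).ne'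
      hh hne
  have hw := restrictLp_nonneg hf₀pos hB
  obtain ⟨q, hq⟩ := hreach _ hw (restrictLp_ne_zero hp hpos₀ hB hB0)
  obtain ⟨M, hM⟩ := exists_forall_rankOne_le hpos hsem (weightedIntegral_nonneg hp f₀ A) hw hq
    hab hc hlow
  refine fun f => ⟨_, exists_tendsto_of_rankOne_le hpos hcontr hsem hcont hf₀pos hfix hdense
    (weightedIntegral_nonneg hp f₀ Set.univ)
    (weightedIntegral_self_pos hp hpos₀ MeasurableSet.univ hμ) hΛT hΛnorm
    (weightedIntegral_nonneg hp f₀ A) hreach hw ?_ hM f⟩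
  rw [weightedIntegral_univ_restrictLp]
  exact weightedIntegral_self_pos hp hpos₀ hB hB0
end
end

section
/- Let (Ω, μ) be a σ-finite measure space, let p ∈ [1, ∞), and let (T_t)_{t ∈ [0,∞)} be a positive and contractive C₀-semigroup on L^p(Ω, μ; ℝ). Assume there exists f₀ ∈ L^p with T_t f₀ = f₀ for all t ≥ 0 and f₀(x) > 0 for μ-almost every x ∈ Ω, and assume that T_{t₀} is an integral operator for at least one time t₀ ≥ 0. Then for every f ∈ L^p the orbit {T_t f : t ∈ [0, ∞)} is relatively compact in L^p. -/
open MeasureTheory Filter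
open scoped ENNReal NNReal

noncomputable section

open scoped Topology

section KernelOperator

variable {α β κ : Type*} [MeasurableSpace α] [MeasurableSpace β]
  {ν : Measure α} {μ : Measure β}

/-- The extended `L¹` norm of `y ↦ ∫ x, K (y, x) * g x ∂μ`. -/
def kernelNorm (ν : Measure α) (μ : Measure β) (K : α × β → ℝ) (g : β → ℝ) : ℝ≥0∞ :=
  ∫⁻ y, ‖∫ x, K (y, x) * g x ∂μ‖ₑ ∂ν

theorem kernelNorm_le [SFinite μ] {K : α × β → ℝ} (hK : Integrable K (ν.prod μ))
    {g : β → ℝ} {C : ℝ≥0} (hg : ∀ᵐ x ∂μ, ‖g x‖ₑ ≤ C) :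
    kernelNorm ν μ K g ≤ C * ∫⁻ z, ‖K z‖ₑ ∂(ν.prod μ) := by
  rw [lintegral_prod _ hK.1.enorm, ← lintegral_const_mul' _ _ ENNReal.coe_ne_top]
  refine lintegral_mono fun y => ?_
  rw [← lintegral_const_mul' _ _ ENNReal.coe_ne_top]
  refine (enorm_integral_le_lintegral_enorm _).trans (lintegral_mono_ae ?_)
  filter_upwards [hg] with x hx
  rw [enorm_mul, mul_comm]
  gcongr

theorem kernelNorm_add_le [SFinite μ] [SFinite ν] {K L : α × β → ℝ}
    (hK : Integrable K (ν.prod μ)) (hL : Integrable L (ν.prod μ))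
    {g : β → ℝ} {C : ℝ≥0} (hgm : AEStronglyMeasurable g μ) (hg : ∀ᵐ x ∂μ, ‖g x‖ₑ ≤ C) :
    kernelNorm ν μ (K + L) g ≤ kernelNorm ν μ K g + kernelNorm ν μ L g := by
  have hg' : ∀ᵐ x ∂μ, ‖g x‖ ≤ C := by
    filter_upwards [hg] with x hx
    rw [enorm_eq_nnnorm] at hx
    exact_mod_cast hx
  have hm : AEMeasurable (fun y => ‖∫ x, K (y, x) * g x ∂μ‖ₑ) ν :=
    (AEStronglyMeasurable.integral_prod_right' (f := fun z : α × β => K z * g z.2)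
      (hK.1.mul hgm.comp_snd)).enorm
  rw [kernelNorm, kernelNorm, kernelNorm, ← lintegral_add_left' hm]
  refine lintegral_mono_ae ?_
  filter_upwards [hK.prod_right_ae, hL.prod_right_ae] with y h1 h2
  simp only [Pi.add_apply, add_mul]
  rw [integral_add (h1.mul_bdd hgm hg') (h2.mul_bdd hgm hg')]
  exact enorm_add_le _ _

theorem kernelNorm_neg (K : α × β → ℝ) (g : β → ℝ) :
    kernelNorm ν μ (-K) g = kernelNorm ν μ K g := by
  simp [kernelNorm, integral_neg]

variable {F : Filter κ} {h : κ → β → ℝ} {C : ℝ≥0}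

theorem tendsto_kernelNorm_rectangle (c : ℝ)
    (hw : ∀ A, MeasurableSet A → μ A ≠ ∞ → Tendsto (fun k => ∫ x in A, h k x ∂μ) F (𝓝 0))
    {B : Set α} {A : Set β} (hB : MeasurableSet B) (hBν : ν B ≠ ∞) (hA : MeasurableSet A)
    (hAμ : μ A ≠ ∞) :
    Tendsto (fun k => kernelNorm ν μ ((B ×ˢ A).indicator fun _ => c) (h k)) F (𝓝 0) := by
  have key : ∀ k, kernelNorm ν μ ((B ×ˢ A).indicator fun _ => c) (h k) =
      ‖c * ∫ x in A, h k x ∂μ‖ₑ * ν B := by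
    intro k
    rw [← lintegral_indicator_const hB, kernelNorm]
    refine lintegral_congr fun y => ?_
    by_cases hy : y ∈ B
    · rw [Set.indicator_of_mem hy, ← integral_const_mul, ← integral_indicator hA]
      congr 2
      ext x
      by_cases hx : x ∈ A <;> simp [hx, hy]
    · simp [hy]
  simp_rw [key]
  have h1 := ((hw A hA hAμ).const_mul c).enorm
  simpa using ENNReal.Tendsto.mul_const h1 (Or.inr hBν)

variable [SigmaFinite μ] [SigmaFinite ν]

theorem tendsto_kernelNorm_add {K L : α × β → ℝ}
    (hm : ∀ k, AEStronglyMeasurable (h k) μ) (hC : ∀ k, ∀ᵐ x ∂μ, ‖h k x‖ₑ ≤ C)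
    (hK : Integrable K (ν.prod μ)) (hL : Integrable L (ν.prod μ))
    (hK0 : Tendsto (fun k => kernelNorm ν μ K (h k)) F (𝓝 0))
    (hL0 : Tendsto (fun k => kernelNorm ν μ L (h k)) F (𝓝 0)) :
    Tendsto (fun k => kernelNorm ν μ (K + L) (h k)) F (𝓝 0) := by
  refine tendsto_of_tendsto_of_tendsto_of_le_of_le tendsto_const_nhds
    (by simpa using hK0.add hL0) (fun _ => zero_le) fun k => ?_
  exact kernelNorm_add_le hK hL (hm k) (hC k)

theorem tendsto_kernelNorm_of_approx {K : α × β → ℝ}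
    (hm : ∀ k, AEStronglyMeasurable (h k) μ) (hC : ∀ k, ∀ᵐ x ∂μ, ‖h k x‖ₑ ≤ C)
    (hK : Integrable K (ν.prod μ))
    (happ : ∀ ε : ℝ≥0∞, 0 < ε → ∃ L : α × β → ℝ, Integrable L (ν.prod μ) ∧
      Tendsto (fun k => kernelNorm ν μ L (h k)) F (𝓝 0) ∧
      ∫⁻ z, ‖K z - L z‖ₑ ∂(ν.prod μ) ≤ ε) :
    Tendsto (fun k => kernelNorm ν μ K (h k)) F (𝓝 0) := by
  rw [ENNReal.tendsto_nhds_zero]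
  intro ε hε
  have hε2 : 0 < ε / 2 := ENNReal.half_pos hε.ne'
  obtain ⟨L, hL, hL0, hKL⟩ := happ (ε / 2 / C) (ENNReal.div_pos hε2.ne' ENNReal.coe_ne_top)
  filter_upwards [ENNReal.tendsto_nhds_zero.1 hL0 _ hε2] with k hk
  calc kernelNorm ν μ K (h k) = kernelNorm ν μ ((K - L) + L) (h k) := by simp
    _ ≤ kernelNorm ν μ (K - L) (h k) + kernelNorm ν μ L (h k) :=
        kernelNorm_add_le (hK.sub hL) hL (hm k) (hC k)
    _ ≤ C * (ε / 2 / C) + ε / 2 := by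
        gcongr
        exact (kernelNorm_le (hK.sub hL) (hC k)).trans (by gcongr; exact hKL)
    _ ≤ ε / 2 + ε / 2 := by
        gcongr
        exact ENNReal.mul_div_le
    _ = ε := ENNReal.add_halves ε

theorem tendsto_kernelNorm_indicator_of_monotone
    (hm : ∀ k, AEStronglyMeasurable (h k) μ) (hC : ∀ k, ∀ᵐ x ∂μ, ‖h k x‖ₑ ≤ C) (c : ℝ)
    {s : ℕ → Set (α × β)} (hs : ∀ n, MeasurableSet (s n)) (hmono : Monotone s)
    (hfin : ν.prod μ (⋃ n, s n) ≠ ∞)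
    (h0 : ∀ n, Tendsto (fun k => kernelNorm ν μ ((s n).indicator fun _ => c) (h k)) F (𝓝 0)) :
    Tendsto (fun k => kernelNorm ν μ ((⋃ n, s n).indicator fun _ => c) (h k)) F (𝓝 0) := by
  have hU := MeasurableSet.iUnion hs
  have hint : ∀ n, Integrable ((s n).indicator fun _ => c) (ν.prod μ) := fun n =>
    (integrable_indicator_iff (hs n)).2 (integrableOn_const
      (ne_top_of_le_ne_top hfin (measure_mono (Set.subset_iUnion _ _))))
  refine tendsto_kernelNorm_of_approx hm hC
    ((integrable_indicator_iff hU).2 (integrableOn_const hfin)) fun ε hε => ?_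
  have hlim : Tendsto (fun n => ‖c‖ₑ * ν.prod μ ((⋃ n, s n) \ s n)) atTop (𝓝 0) := by
    have := tendsto_measure_iInter_atTop (μ := ν.prod μ) (s := fun n => (⋃ n, s n) \ s n)
      (fun n => (hU.diff (hs n)).nullMeasurableSet)
      (fun i j hij => Set.sdiff_subset_sdiff_right (hmono hij))
      ⟨0, ne_top_of_le_ne_top hfin (measure_mono Set.sdiff_subset)⟩
    rw [← Set.sdiff_iUnion, Set.sdiff_self, measure_empty] at this
    simpa using ENNReal.Tendsto.const_mul this (Or.inr enorm_ne_top)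
  obtain ⟨n, hn⟩ := (ENNReal.tendsto_nhds_zero.1 hlim ε hε).exists
  refine ⟨_, hint n, h0 n, le_trans (le_of_eq ?_) hn⟩
  rw [← lintegral_indicator_const (hU.diff (hs n))]
  refine lintegral_congr fun z => ?_
  by_cases h1 : z ∈ s n
  · have h2 : z ∈ ⋃ n, s n := Set.mem_iUnion_of_mem n h1
    rw [Set.indicator_of_mem h2, Set.indicator_of_mem h1,
      Set.indicator_of_notMem (fun h => h.2 h1), sub_self, enorm_zero]
  · by_cases h2 : z ∈ ⋃ n, s n
    · rw [Set.indicator_of_mem h2, Set.indicator_of_notMem h1,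
        Set.indicator_of_mem (show z ∈ _ \ _ from ⟨h2, h1⟩), sub_zero]
    · rw [Set.indicator_of_notMem h2, Set.indicator_of_notMem h1,
        Set.indicator_of_notMem (fun h => h2 h.1), sub_zero, enorm_zero]

theorem tendsto_kernelNorm_indicator_inter
    (hm : ∀ k, AEStronglyMeasurable (h k) μ) (hC : ∀ k, ∀ᵐ x ∂μ, ‖h k x‖ₑ ≤ C) (c : ℝ)
    (hw : ∀ A, MeasurableSet A → μ A ≠ ∞ → Tendsto (fun k => ∫ x in A, h k x ∂μ) F (𝓝 0))
    {B : Set α} {A : Set β} (hB : MeasurableSet B) (hBν : ν B ≠ ∞) (hA : MeasurableSet A)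
    (hAμ : μ A ≠ ∞) {s : Set (α × β)} (hs : MeasurableSet s) :
    Tendsto (fun k => kernelNorm ν μ ((s ∩ B ×ˢ A).indicator fun _ => c) (h k)) F (𝓝 0) := by
  have hR := hB.prod hA
  have hRfin : ν.prod μ (B ×ˢ A) ≠ ∞ := by
    rw [Measure.prod_prod]
    exact ENNReal.mul_ne_top hBν hAμ
  have hint : ∀ (t : Set (α × β)) (c : ℝ), MeasurableSet t →
      Integrable ((t ∩ B ×ˢ A).indicator fun _ => c) (ν.prod μ) := fun t c ht =>
    (integrable_indicator_iff (ht.inter hR)).2 (integrableOn_const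
      (ne_top_of_le_ne_top hRfin (measure_mono Set.inter_subset_right)))
  induction s, hs using MeasurableSpace.induction_on_inter generateFrom_prod.symm isPiSystem_prod with
  | empty => simpa [kernelNorm] using tendsto_const_nhds
  | basic t ht =>
    obtain ⟨B', hB', A', hA', rfl⟩ := ht
    rw [Set.prod_inter_prod]
    exact tendsto_kernelNorm_rectangle c hw (MeasurableSet.inter hB' hB)
      (ne_top_of_le_ne_top hBν (measure_mono Set.inter_subset_right))
      (MeasurableSet.inter hA' hA)
      (ne_top_of_le_ne_top hAμ (measure_mono Set.inter_subset_right))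
  | compl t ht ih =>
    have hsub : ((tᶜ ∩ B ×ˢ A).indicator fun _ => c) =
        ((B ×ˢ A).indicator fun _ => c) + -((t ∩ B ×ˢ A).indicator fun _ => c) := by
      ext z
      by_cases h1 : z ∈ t <;> by_cases h2 : z ∈ B ×ˢ A <;>
        simp only [Pi.add_apply, Pi.neg_apply, Set.indicator, Set.mem_inter_iff,
          Set.mem_compl_iff, h1, h2] <;> simp
    rw [hsub]
    refine tendsto_kernelNorm_add hm hC ?_ (hint t c ht).neg
      (tendsto_kernelNorm_rectangle c hw hB hBν hA hAμ) (by simpa only [kernelNorm_neg] using ih)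
    simpa using hint Set.univ c .univ
  | iUnion f hd hf ih =>
    have hacc : ∀ n, MeasurableSet (Set.accumulate f n) := fun n =>
      MeasurableSet.biUnion (Set.to_countable _) fun i _ => hf i
    rw [← Set.iUnion_accumulate, Set.iUnion_inter]
    refine tendsto_kernelNorm_indicator_of_monotone hm hC c (fun n => (hacc n).inter hR)
      (fun i j hij => Set.inter_subset_inter_left _ (Set.monotone_accumulate hij))
      (ne_top_of_le_ne_top hRfin
        (measure_mono (Set.iUnion_subset fun _ => Set.inter_subset_right))) fun n => ?_
    induction n with
    | zero => simpa using ih 0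
    | succ n ihn =>
      have hdis : Disjoint (Set.accumulate f n ∩ B ×ˢ A) (f (n + 1) ∩ B ×ˢ A) :=
        (Set.disjoint_accumulate hd n.lt_succ_self).mono Set.inter_subset_left
          Set.inter_subset_left
      rw [Set.accumulate_succ, Set.union_inter_distrib_right, Set.indicator_union_of_disjoint hdis]
      exact tendsto_kernelNorm_add hm hC (hint _ c (hacc n)) (hint _ c (hf _)) ihn (ih _)

/-- An integrable kernel turns weak convergence of a bounded family of functions into
convergence in `L¹`. -/
theorem tendsto_kernelNorm_of_tendsto_setIntegral
    (hm : ∀ k, AEStronglyMeasurable (h k) μ) (hC : ∀ k, ∀ᵐ x ∂μ, ‖h k x‖ₑ ≤ C)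
    (hw : ∀ A, MeasurableSet A → μ A ≠ ∞ → Tendsto (fun k => ∫ x in A, h k x ∂μ) F (𝓝 0))
    {K : α × β → ℝ} (hK : Integrable K (ν.prod μ)) :
    Tendsto (fun k => kernelNorm ν μ K (h k)) F (𝓝 0) := by
  have hset : ∀ (c : ℝ) ⦃s : Set (α × β)⦄, MeasurableSet s → ν.prod μ s < ∞ →
      Tendsto (fun k => kernelNorm ν μ (s.indicator fun _ => c) (h k)) F (𝓝 0) := by
    intro c s hs hsfin
    have hsU : s = ⋃ n, s ∩ spanningSets ν n ×ˢ spanningSets μ n := by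
      rw [← Set.inter_iUnion, Set.iUnion_prod_of_monotone (monotone_spanningSets ν)
        (monotone_spanningSets μ), iUnion_spanningSets, iUnion_spanningSets]
      simp
    rw [hsU] at hsfin ⊢
    refine tendsto_kernelNorm_indicator_of_monotone hm hC c (fun n => hs.inter
      ((measurableSet_spanningSets ν n).prod (measurableSet_spanningSets μ n)))
      (fun i j hij => Set.inter_subset_inter_right _ (Set.prod_mono
        (monotone_spanningSets ν hij) (monotone_spanningSets μ hij))) hsfin.ne fun n => ?_
    exact tendsto_kernelNorm_indicator_inter hm hC c hw (measurableSet_spanningSets ν n)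
      (measure_spanningSets_lt_top ν n).ne (measurableSet_spanningSets μ n)
      (measure_spanningSets_lt_top μ n).ne hs
  refine hK.induction _ hset (fun f g _ hf hg => tendsto_kernelNorm_add hm hC hf hg) ?_ ?_
  · refine isClosed_of_closure_subset fun f hf => ?_
    refine tendsto_kernelNorm_of_approx hm hC (L1.integrable_coeFn f) fun ε hε => ?_
    obtain ⟨L, hL, hfL⟩ := EMetric.mem_closure_iff.1 hf ε hε
    refine ⟨L, L1.integrable_coeFn L, hL, ?_⟩
    rw [L1.edist_def] at hfL
    simpa only [edist_eq_enorm_sub] using hfL.le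
  · intro f g hfg hf hf0
    refine tendsto_kernelNorm_of_approx hm hC (hf.congr hfg) fun ε hε => ⟨f, hf, hf0, ?_⟩
    rw [lintegral_congr_ae (g := fun _ => 0) (by filter_upwards [hfg] with z hz; simp [hz])]
    simp

end KernelOperator

section IntegralOperator

variable {Ω : Type*} [MeasurableSpace Ω] {μ : Measure Ω} {p : ℝ≥0∞}

theorem ae_abs_le_of_mem_Icc {c : ℝ} {f₀ f : Lp ℝ p μ}
    (hf : f ∈ Set.Icc (-(c • f₀)) (c • f₀)) : ∀ᵐ x ∂μ, |f x| ≤ c * f₀ x := by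
  have h1 := (Lp.coeFn_le _ _).2 hf.1
  have h2 := (Lp.coeFn_le _ _).2 hf.2
  filter_upwards [h1, h2, Lp.coeFn_neg (c • f₀), Lp.coeFn_smul c f₀] with x h1 h2 h3 h4
  rw [h3, Pi.neg_apply, h4, Pi.smul_apply, smul_eq_mul] at h1
  rw [h4, Pi.smul_apply, smul_eq_mul] at h2
  exact abs_le.2 ⟨h1, h2⟩

theorem mem_Icc_of_ae_abs_le {c : ℝ} {f₀ f : Lp ℝ p μ} (hf : ∀ᵐ x ∂μ, |f x| ≤ c * f₀ x) :
    f ∈ Set.Icc (-(c • f₀)) (c • f₀) := by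
  constructor <;> rw [← Lp.coeFn_le]
  · filter_upwards [hf, Lp.coeFn_neg (c • f₀), Lp.coeFn_smul c f₀] with x hx h3 h4
    rw [h3, Pi.neg_apply, h4, Pi.smul_apply, smul_eq_mul]
    exact (abs_le.1 hx).1
  · filter_upwards [hf, Lp.coeFn_smul c f₀] with x hx h4
    rw [h4, Pi.smul_apply, smul_eq_mul]
    exact (abs_le.1 hx).2

variable [Fact (1 ≤ p)]

theorem Lp.edist_rpow_toReal (hp : p ≠ ∞) (f g : Lp ℝ p μ) :
    edist f g ^ p.toReal = ∫⁻ x, ‖f x - g x‖ₑ ^ p.toReal ∂μ := by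
  have hp1 : 1 ≤ p := Fact.out
  have hp0 : p ≠ 0 := (zero_lt_one.trans_le hp1).ne'
  rw [Lp.edist_def, eLpNorm_eq_lintegral_rpow_enorm_toReal hp0 hp, ← ENNReal.rpow_mul,
    one_div_mul_cancel (ENNReal.toReal_pos hp0 hp).ne', ENNReal.rpow_one]
  rfl

/-- Multiples of a function that is positive almost everywhere generate a dense ideal. -/
theorem exists_mem_Icc_dist_lt (hp : p ≠ ∞) {f₀ : Lp ℝ p μ} (hf₀ : ∀ᵐ x ∂μ, 0 < f₀ x)
    (f : Lp ℝ p μ) {ε : ℝ} (hε : 0 < ε) :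
    ∃ c : ℝ, 0 ≤ c ∧ ∃ g ∈ Set.Icc (-(c • f₀)) (c • f₀), dist f g < ε := by
  have hp1 : 1 ≤ p := Fact.out
  have hp0 : p ≠ 0 := (zero_lt_one.trans_le hp1).ne'
  have hr : 0 < p.toReal := ENNReal.toReal_pos hp0 hp
  let S : ℕ → Set Ω := fun n => {x | |f x| ≤ n * f₀ x}
  have hfm := (Lp.stronglyMeasurable f).measurable
  have hf₀m := (Lp.stronglyMeasurable f₀).measurable
  have hS : ∀ n, MeasurableSet (S n) := fun n =>
    measurableSet_le hfm.abs (hf₀m.const_mul _)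
  let g : ℕ → Lp ℝ p μ := fun n => ((Lp.memLp f).indicator (hS n)).toLp
  have hg : ∀ n, g n =ᵐ[μ] (S n).indicator f := fun n => MemLp.coeFn_toLp _
  have hlim : Tendsto (fun n => edist f (g n) ^ p.toReal) atTop (𝓝 0) := by
    have heq : ∀ n, edist f (g n) ^ p.toReal =
        ∫⁻ x, ‖f x - (S n).indicator f x‖ₑ ^ p.toReal ∂μ := fun n => by
      rw [Lp.edist_rpow_toReal hp]
      refine lintegral_congr_ae ?_
      filter_upwards [hg n] with x hx
      rw [hx]
    simp_rw [heq]
    rw [← lintegral_zero (μ := μ)]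
    refine tendsto_lintegral_of_dominated_convergence (fun x => ‖f x‖ₑ ^ p.toReal)
      (fun n => ((hfm.sub (hfm.indicator (hS n))).enorm.pow_const _)) (fun n => ?_) ?_ ?_
    · refine Eventually.of_forall fun x => ?_
      dsimp only
      gcongr
      by_cases hx : x ∈ S n <;> simp [hx]
    · exact (lintegral_rpow_enorm_lt_top_of_eLpNorm_lt_top hp0 hp (Lp.memLp f).2).ne
    · filter_upwards [hf₀] with x hx
      refine tendsto_const_nhds.congr' ?_
      obtain ⟨N, hN⟩ := exists_nat_ge (|f x| / f₀ x)
      filter_upwards [eventually_ge_atTop N] with n hn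
      have hxn : x ∈ S n := by
        have : |f x| / f₀ x ≤ n := hN.trans (by exact_mod_cast hn)
        exact (div_le_iff₀ hx).1 this
      simp [hxn, hr]
  have hε' : 0 < ENNReal.ofReal ε ^ p.toReal :=
    ENNReal.rpow_pos (ENNReal.ofReal_pos.2 hε) ENNReal.ofReal_ne_top
  obtain ⟨n, hn⟩ := (hlim.eventually_lt_const hε').exists
  refine ⟨n, n.cast_nonneg, g n, mem_Icc_of_ae_abs_le ?_, ?_⟩
  · filter_upwards [hg n, hf₀] with x hx h0
    rw [hx]
    by_cases hxn : x ∈ S n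
    · rw [Set.indicator_of_mem hxn]
      exact hxn
    · simpa [hxn] using by positivity
  · rw [ENNReal.rpow_lt_rpow_iff hr, edist_lt_ofReal] at hn
    exact hn

/-- Integral operators map order intervals to totally bounded sets. -/
theorem IsIntegralOp.totallyBounded_image_Icc [SigmaFinite μ] (hp : p ≠ ∞)
    {T : Lp ℝ p μ →L[ℝ] Lp ℝ p μ} (hT : IsIntegralOp T) {f₀ : Lp ℝ p μ}
    (hf₀ : ∀ᵐ x ∂μ, 0 < f₀ x) {c : ℝ} (hc : 0 ≤ c) :
    TotallyBounded (T '' Set.Icc (-(c • f₀)) (c • f₀)) := by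
  have hp1 : 1 ≤ p := Fact.out
  have hp0 : p ≠ 0 := (zero_lt_one.trans_le hp1).ne'
  have hr : 0 < p.toReal := ENNReal.toReal_pos hp0 hp
  have hr1 : 0 ≤ p.toReal - 1 := by
    have := (ENNReal.toReal_le_toReal ENNReal.one_ne_top hp).2 hp1
    rw [ENNReal.toReal_one] at this
    linarith
  have hrpow : ∀ d : ℝ, 0 ≤ d → d ^ p.toReal = d ^ (p.toReal - 1) * d := fun d hd => by
    rw [← Real.rpow_add_one' hd (by simpa using hr.ne'), sub_add_cancel]
  obtain ⟨k, hkm, hk0, hk⟩ := hT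
  have hf₀m := (Lp.stronglyMeasurable f₀).measurable
  have hkm' : Measurable fun z : Ω × Ω => k z.2 z.1 := hkm.comp measurable_swap
  let H : Ω → ℝ := fun y => ∫ x, k x y * f₀ x ∂μ
  have hHm : Measurable H :=
    (StronglyMeasurable.integral_prod_right (ν := μ)
      (f := fun y x => k x y * f₀ x)
      (hkm'.mul (hf₀m.comp measurable_snd)).stronglyMeasurable).measurable
  have hH0 : ∀ y, 0 ≤ H y := fun y => integral_nonneg_of_ae (by
    filter_upwards [hf₀] with x hx
    exact mul_nonneg (hk0 x y) hx.le)
  let K : Ω × Ω → ℝ := fun z => H z.1 ^ (p.toReal - 1) * (k z.2 z.1 * f₀ z.2)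
  have hKm : Measurable K :=
    ((hHm.comp measurable_fst).pow_const _).mul (hkm'.mul (hf₀m.comp measurable_snd))
  have hK : Integrable K (μ.prod μ) := by
    rw [integrable_prod_iff hKm.aestronglyMeasurable]
    refine ⟨?_, ?_⟩
    · filter_upwards [(hk f₀).1] with y hy
      exact hy.const_mul (H y ^ (p.toReal - 1))
    · have : (fun y => ∫ x, ‖K (y, x)‖ ∂μ) = fun y => H y ^ p.toReal := by
        ext y
        rw [hrpow _ (hH0 y), ← integral_const_mul]
        refine integral_congr_ae ?_
        filter_upwards [hf₀] with x hx
        exact Real.norm_of_nonneg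
          (mul_nonneg (Real.rpow_nonneg (hH0 y) _) (mul_nonneg (hk0 x y) hx.le))
      rw [this]
      refine ((Lp.memLp (T f₀)).integrable_norm_rpow hp0 hp).congr ?_
      filter_upwards [(hk f₀).2] with y hy
      rw [hy, Real.norm_of_nonneg (hH0 y)]
  let I := Set.Icc (-(c • f₀)) (c • f₀)
  let G : Lp ℝ p μ → Ω → ℝ := fun f x => f x / f₀ x
  have hGm : ∀ f, AEStronglyMeasurable (G f) μ := fun f =>
    ((Lp.stronglyMeasurable f).measurable.div hf₀m).aestronglyMeasurable
  have hGc : ∀ f ∈ I, ∀ᵐ x ∂μ, ‖G f x‖ ≤ c := fun f hf => by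
    filter_upwards [ae_abs_le_of_mem_Icc hf, hf₀] with x hx h0
    rw [Real.norm_eq_abs, abs_div, abs_of_pos h0]
    exact (div_le_iff₀ h0).2 hx
  -- the domination of the `Lᵖ` distance by the `L¹` norm with respect to the weighted kernel
  have hdom : ∀ f ∈ I, ∀ g ∈ I, edist (T f) (T g) ^ p.toReal ≤
      ENNReal.ofReal ((2 * c) ^ (p.toReal - 1)) * kernelNorm μ μ K (G f - G g) := by
    intro f hf g hg
    rw [Lp.edist_rpow_toReal hp, kernelNorm, ← lintegral_const_mul' _ _ ENNReal.ofReal_ne_top]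
    refine lintegral_mono_ae ?_
    filter_upwards [(hk f).1, (hk f).2, (hk g).1, (hk g).2, (hk f₀).1] with y h1 h2 h3 h4 h5
    have hsub : T f y - T g y = ∫ x, k x y * (f x - g x) ∂μ := by
      rw [h2, h4, ← integral_sub h1 h3]
      simp only [mul_sub]
    have hbd : |T f y - T g y| ≤ 2 * c * H y := by
      rw [hsub, ← integral_const_mul, ← Real.norm_eq_abs]
      refine norm_integral_le_of_norm_le (h5.const_mul _) ?_
      filter_upwards [ae_abs_le_of_mem_Icc hf, ae_abs_le_of_mem_Icc hg] with x hx1 hx2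
      rw [norm_mul, Real.norm_of_nonneg (hk0 x y), Real.norm_eq_abs]
      calc k x y * |f x - g x| ≤ k x y * (|f x| + |g x|) :=
            mul_le_mul_of_nonneg_left (abs_sub _ _) (hk0 x y)
        _ ≤ k x y * (c * f₀ x + c * f₀ x) :=
            mul_le_mul_of_nonneg_left (add_le_add hx1 hx2) (hk0 x y)
        _ = 2 * c * (k x y * f₀ x) := by ring
    have hint : ∫ x, K (y, x) * (G f - G g) x ∂μ =
        H y ^ (p.toReal - 1) * (T f y - T g y) := by
      rw [hsub, ← integral_const_mul]
      refine integral_congr_ae ?_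
      filter_upwards [hf₀] with x hx
      simp only [K, G, Pi.sub_apply]
      field_simp
    rw [hint, ← ofReal_norm, ← ofReal_norm,
      ENNReal.ofReal_rpow_of_nonneg (norm_nonneg _) hr.le,
      ← ENNReal.ofReal_mul (by positivity)]
    refine ENNReal.ofReal_le_ofReal ?_
    rw [hrpow _ (norm_nonneg _), norm_mul, Real.norm_of_nonneg (Real.rpow_nonneg (hH0 y) _),
      ← mul_assoc, ← Real.mul_rpow (by positivity) (hH0 y)]
    exact mul_le_mul_of_nonneg_right (Real.rpow_le_rpow (norm_nonneg _) hbd hr1) (norm_nonneg _)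
  rw [totallyBounded_iff_ultrafilter]
  intro V hV
  let m : I → Lp ℝ p μ := fun f => T f
  have hmV : m '' Set.univ ∈ V := by
    rw [Set.image_univ]
    convert! le_principal_iff.1 hV using 1
    exact (Set.image_eq_range _ _).symm
  let U := Ultrafilter.ofComapInfPrincipal hmV
  have hUV : U.map m = V := Ultrafilter.ofComapInfPrincipal_eq_of_map hmV
  rw [← hUV, Ultrafilter.coe_map, cauchy_map_iff]
  refine ⟨inferInstance, ?_⟩
  have hGint : ∀ A, μ A ≠ ∞ → ∀ f : I, Integrable (G f) (μ.restrict A) := fun A hA f => by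
    have : IsFiniteMeasure (μ.restrict A) := isFiniteMeasure_restrict.2 hA
    exact Integrable.of_bound (hGm f).restrict c (ae_restrict_of_ae (hGc f f.2))
  have hweak : ∀ A, MeasurableSet A → μ A ≠ ∞ →
      Tendsto (fun q : I × I => ∫ x in A, (G q.1 - G q.2) x ∂μ) (U ×ˢ U) (𝓝 0) := by
    intro A _ hA
    let φ : I → ℝ := fun f => ∫ x in A, G f x ∂μ
    have hφ : ∀ f, φ f ∈ Metric.closedBall (0 : ℝ) (c * μ.real A) := fun f => by
      rw [mem_closedBall_zero_iff]
      exact norm_setIntegral_le_of_norm_le_const_ae hA.lt_top (ae_restrict_of_ae (hGc f f.2))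
    obtain ⟨l, -, hl⟩ := isCompact_iff_ultrafilter_le_nhds.1
      (isCompact_closedBall (0 : ℝ) (c * μ.real A)) (U.map φ)
      (le_principal_iff.2 (Ultrafilter.mem_map.2 (Eventually.of_forall hφ)))
    have hl' : Tendsto φ U (𝓝 l) := hl
    have := (hl'.comp tendsto_fst).sub (hl'.comp (tendsto_snd (f := (U : Filter I))))
    rw [sub_self] at this
    refine this.congr fun q => ?_
    exact (integral_sub (hGint A hA q.1) (hGint A hA q.2)).symm
  have hlim := tendsto_kernelNorm_of_tendsto_setIntegral (ν := μ) (C := (2 * c).toNNReal)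
    (fun q : I × I => (hGm q.1).sub (hGm q.2)) (fun q => ?_) hweak hK
  · rw [uniformity_basis_edist.tendsto_right_iff]
    intro ε hε
    have hlim' := ENNReal.Tendsto.const_mul (a := ENNReal.ofReal ((2 * c) ^ (p.toReal - 1)))
      hlim (Or.inr ENNReal.ofReal_ne_top)
    rw [mul_zero] at hlim'
    have hε' : 0 < ε ^ p.toReal := by
      rw [← ENNReal.zero_rpow_of_pos hr]
      exact ENNReal.rpow_lt_rpow hε hr
    filter_upwards [hlim'.eventually_lt_const hε'] with q hq
    exact (ENNReal.rpow_lt_rpow_iff hr).1 ((hdom _ q.1.2 _ q.2.2).trans_lt hq)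
  · filter_upwards [hGc q.1 q.1.2, hGc q.2 q.2.2] with x h1 h2
    rw [← ofReal_norm]
    refine ENNReal.ofReal_le_ofReal ((norm_sub_le _ _).trans ?_)
    linarith

end IntegralOperator

theorem IsPositiveOp.mapsTo_Icc {Ω : Type*} [MeasurableSpace Ω] {μ : Measure Ω} {p : ℝ≥0∞}
    [Fact (1 ≤ p)] {T : Lp ℝ p μ →L[ℝ] Lp ℝ p μ} (hT : IsPositiveOp T) {f₀ : Lp ℝ p μ}
    (hfix : T f₀ = f₀) (c : ℝ) :
    Set.MapsTo T (Set.Icc (-(c • f₀)) (c • f₀)) (Set.Icc (-(c • f₀)) (c • f₀)) := by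
  have hmono : ∀ f g, f ≤ g → T f ≤ T g := fun f g hfg => by
    simpa using hT (g - f) (sub_nonneg.2 hfg)
  rintro f ⟨h1, h2⟩
  have h1' := hmono _ _ h1
  have h2' := hmono _ _ h2
  rw [map_neg, map_smul, hfix] at h1'
  rw [map_smul, hfix] at h2'
  exact ⟨h1', h2'⟩

/-- Under the hypotheses of Greiner's theorem, every orbit of the semigroup is
relatively compact in `L^p`. -/
theorem greiner_orbits_relatively_compact
    {Ω : Type*} [MeasurableSpace Ω] (μ : Measure Ω) [SigmaFinite μ]
    (p : ℝ≥0∞) [Fact (1 ≤ p)] (hp : p ≠ ∞)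
    (T : ℝ≥0 → (Lp ℝ p μ →L[ℝ] Lp ℝ p μ))
    (hpos : ∀ t, IsPositiveOp (T t))
    (hcontr : ∀ t (f : Lp ℝ p μ), ‖T t f‖ ≤ ‖f‖)
    (hT0 : T 0 = ContinuousLinearMap.id ℝ (Lp ℝ p μ))
    (hsem : ∀ s t, T (s + t) = (T s).comp (T t))
    (hcont : ∀ f : Lp ℝ p μ, Continuous fun t => T t f)
    (f₀ : Lp ℝ p μ) (hfix : ∀ t, T t f₀ = f₀)
    (hf₀pos : ∀ᵐ x ∂μ, 0 < f₀ x)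
    (t₀ : ℝ≥0) (hker : IsIntegralOp (T t₀)) :
    ∀ f : Lp ℝ p μ, IsCompact (closure (Set.range fun t => T t f)) := by
  intro f
  have hTB : TotallyBounded (Set.range fun t => T t f) := by
    rw [Metric.totallyBounded_iff]
    intro ε hε
    obtain ⟨c, hc, g, hg, hfg⟩ := exists_mem_Icc_dist_lt hp hf₀pos f (half_pos hε)
    have hsub : (Set.range fun t => T t g) ⊆
        (fun t => T t g) '' Set.Icc 0 t₀ ∪ T t₀ '' Set.Icc (-(c • f₀)) (c • f₀) := by
      rintro _ ⟨t, rfl⟩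
      rcases le_total t t₀ with h | h
      · exact Or.inl ⟨t, ⟨zero_le, h⟩, rfl⟩
      · refine Or.inr ⟨T (t - t₀) g, (hpos _).mapsTo_Icc (hfix _) c hg, ?_⟩
        rw [← ContinuousLinearMap.comp_apply, ← hsem, add_tsub_cancel_of_le h]
    have hgTB : TotallyBounded (Set.range fun t => T t g) :=
      ((isCompact_Icc.image (hcont g)).totallyBounded.union
        (hker.totallyBounded_image_Icc hp hf₀pos hc)).subset hsub
    obtain ⟨s, hs, hcov⟩ := Metric.totallyBounded_iff.1 hgTB (ε / 2) (half_pos hε)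
    refine ⟨s, hs, ?_⟩
    rintro _ ⟨t, rfl⟩
    obtain ⟨y, hy, hty⟩ := Set.mem_iUnion₂.1 (hcov ⟨t, rfl⟩)
    refine Set.mem_iUnion₂.2 ⟨y, hy, ?_⟩
    have hd : dist (T t f) (T t g) ≤ dist f g := by
      rw [dist_eq_norm, dist_eq_norm, ← map_sub]
      exact hcontr t _
    rw [Metric.mem_ball] at hty ⊢
    linarith [dist_triangle (T t f) (T t g) y]
  exact hTB.closure.isCompact_of_isClosed isClosed_closure
end
end

section
/- Let (Ω, μ) be a σ-finite measure space, let p ∈ [1, ∞), and let T be a positive bounded linear operator on L^p(Ω, μ; ℝ) which is an integral operator. Then for all f, g ∈ L^p with f ≤ g, the image T([f, g]) of the order interval [f, g] = {h ∈ L^p : f ≤ h ≤ g} is relatively compact in L^p. -/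
open MeasureTheory Filter
open scoped ENNReal NNReal

noncomputable section

section Auxiliary

open scoped Topology

section WeakConvergence

variable {Ω : Type*} [MeasurableSpace Ω] {μ : Measure Ω}

/-- The integrable function `u` has convergent pairings with the sequence `φ`. -/
def PairingConverges (μ : Measure Ω) (φ : ℕ → Ω → ℝ) (u : Ω → ℝ) : Prop :=
  Integrable u μ ∧ ∃ l, Tendsto (fun n => ∫ x, u x * φ n x ∂μ) atTop (𝓝 l)

/-- A sequence of measurable functions with values in `[-1, 1]`. -/
def IsUnitBounded (φ : ℕ → Ω → ℝ) : Prop :=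
  (∀ n, Measurable (φ n)) ∧ ∀ n x, |φ n x| ≤ 1

lemma IsUnitBounded.integrable_mul {φ : ℕ → Ω → ℝ} (hφ : IsUnitBounded φ) {u : Ω → ℝ}
    (hu : Integrable u μ) (n : ℕ) : Integrable (fun x => u x * φ n x) μ :=
  hu.mul_bdd (c := 1) (hφ.1 n).aestronglyMeasurable (Eventually.of_forall (hφ.2 n))

lemma PairingConverges.zero (φ : ℕ → Ω → ℝ) : PairingConverges μ φ (fun _ => 0) :=
  ⟨integrable_zero _ _ _, 0, by simp⟩

lemma PairingConverges.add {φ : ℕ → Ω → ℝ} (hφ : IsUnitBounded φ) {u v : Ω → ℝ}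
    (hu : PairingConverges μ φ u) (hv : PairingConverges μ φ v) :
    PairingConverges μ φ (fun x => u x + v x) := by
  obtain ⟨hui, a, ha⟩ := hu
  obtain ⟨hvi, b, hb⟩ := hv
  refine ⟨hui.add hvi, a + b, (ha.add hb).congr fun n => ?_⟩
  rw [← integral_add (hφ.integrable_mul hui n) (hφ.integrable_mul hvi n)]
  simp_rw [add_mul]

lemma PairingConverges.const_mul {φ : ℕ → Ω → ℝ} {u : Ω → ℝ}
    (hu : PairingConverges μ φ u) (c : ℝ) : PairingConverges μ φ (fun x => c * u x) := by
  obtain ⟨hui, a, ha⟩ := hu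
  refine ⟨hui.const_mul c, c * a, (ha.const_mul c).congr fun n => ?_⟩
  rw [← integral_const_mul]
  simp_rw [mul_assoc]

lemma PairingConverges.sum {φ : ℕ → Ω → ℝ} (hφ : IsUnitBounded φ) {ι : Type*} (s : Finset ι)
    {u : ι → Ω → ℝ} (hu : ∀ i ∈ s, PairingConverges μ φ (u i)) :
    PairingConverges μ φ (fun x => ∑ i ∈ s, u i x) := by
  classical
  induction s using Finset.induction_on with
  | empty => simpa using PairingConverges.zero φ
  | insert a s ha ih =>
    simp_rw [Finset.sum_insert ha]
    exact (hu a (by simp)).add hφ (ih fun i hi => hu i (by simp [hi]))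

/-- Convergence of pairings passes to dominated limits. -/
lemma PairingConverges.of_dominated {φ : ℕ → Ω → ℝ} (hφ : IsUnitBounded φ)
    {u : ℕ → Ω → ℝ} {v b : Ω → ℝ} (hb : Integrable b μ) (hub : ∀ N x, |u N x| ≤ b x)
    (hlim : ∀ x, Tendsto (fun N => u N x) atTop (𝓝 (v x)))
    (hu : ∀ N, PairingConverges μ φ (u N)) : PairingConverges μ φ v := by
  have hvm : AEStronglyMeasurable v μ :=
    aestronglyMeasurable_of_tendsto_ae atTop (fun N => (hu N).1.aestronglyMeasurable)
      (Eventually.of_forall hlim)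
  have hvb : ∀ x, |v x| ≤ b x := fun x =>
    le_of_tendsto (hlim x).abs (Eventually.of_forall fun N => hub N x)
  have hvi : Integrable v μ := hb.mono' hvm (Eventually.of_forall hvb)
  refine ⟨hvi, cauchySeq_tendsto_of_complete ?_⟩
  have h0 : Tendsto (fun N => ∫ x, |u N x - v x| ∂μ) atTop (𝓝 0) := by
    have := tendsto_integral_of_dominated_convergence (μ := μ)
      (F := fun N x => |u N x - v x|) (f := fun _ => 0) (fun x => b x + b x)
      (fun N => ((hu N).1.sub hvi).abs.aestronglyMeasurable) (hb.add hb)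
      (fun N => Eventually.of_forall fun x => by
        rw [Real.norm_eq_abs, abs_abs]
        exact (abs_sub _ _).trans (add_le_add (hub N x) (hvb x)))
      (Eventually.of_forall fun x => by
        simpa using ((hlim x).sub_const (v x)).abs)
    simpa using this
  have hclose : ∀ N n, |∫ x, u N x * φ n x ∂μ - ∫ x, v x * φ n x ∂μ|
      ≤ ∫ x, |u N x - v x| ∂μ := fun N n => by
    rw [← integral_sub (hφ.integrable_mul (hu N).1 n) (hφ.integrable_mul hvi n)]
    refine (abs_integral_le_integral_abs).trans (integral_mono_of_nonneg
      (Eventually.of_forall fun x => abs_nonneg _) ((hu N).1.sub hvi).abs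
      (Eventually.of_forall fun x => ?_))
    change |u N x * φ n x - v x * φ n x| ≤ |u N x - v x|
    rw [← sub_mul, abs_mul]
    exact mul_le_of_le_one_right (abs_nonneg _) (hφ.2 n x)
  rw [Metric.cauchySeq_iff']
  intro ε hε
  obtain ⟨N, hN⟩ := (h0.eventually_lt_const (show 0 < ε / 3 by positivity)).exists
  obtain ⟨l, hl⟩ := (hu N).2
  obtain ⟨n₀, hn₀⟩ := Metric.cauchySeq_iff'.1 hl.cauchySeq (ε / 3) (by positivity)
  refine ⟨n₀, fun n hn => ?_⟩
  have h1 := abs_le.1 (hclose N n)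
  have h2 := abs_le.1 (hclose N n₀)
  have h3 := hn₀ n hn
  rw [Real.dist_eq, abs_lt] at h3 ⊢
  constructor <;> linarith [h3.1, h3.2]

/-- Convergence of the pairings with all sections of a measurable subset of the product follows
from convergence of the pairings with countably many sets of finite measure. -/
lemma exists_countable_forall_pairingConverges_section {Y : Type*} [MeasurableSpace Y]
    {S : Set Ω} (hS : MeasurableSet S) (hμS : μ S ≠ ∞) {s : Set (Ω × Y)}
    (hs : MeasurableSet s) :
    ∃ 𝒜 : Set (Set Ω), 𝒜.Countable ∧ (∀ A ∈ 𝒜, MeasurableSet A ∧ μ A ≠ ∞) ∧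
      ∀ φ : ℕ → Ω → ℝ, IsUnitBounded φ →
        (∀ A ∈ 𝒜, PairingConverges μ φ (A.indicator 1)) →
        ∀ y, PairingConverges μ φ ((S ∩ (fun x => (x, y)) ⁻¹' s).indicator 1) := by
  induction s, hs using MeasurableSpace.induction_on_inter generateFrom_prod.symm
    isPiSystem_prod with
  | empty =>
    refine ⟨∅, Set.countable_empty, by simp, fun φ _ _ y => ?_⟩
    simpa using PairingConverges.zero φ
  | basic t ht =>
    obtain ⟨A, hA, B, hB, rfl⟩ := ht
    refine ⟨{S ∩ A}, Set.countable_singleton _, ?_, fun φ _ h y => ?_⟩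
    · rintro _ rfl
      exact ⟨hS.inter hA, measure_ne_top_of_subset Set.inter_subset_left hμS⟩
    · by_cases hy : y ∈ B
      · have : (fun x => (x, y)) ⁻¹' (A ×ˢ B) = A := by ext; simp [hy]
        rw [this]
        exact h _ rfl
      · have : (fun x => (x, y)) ⁻¹' (A ×ˢ B) = ∅ := by ext; simp [hy]
        rw [this]
        simpa using PairingConverges.zero φ
  | compl t htm ih =>
    obtain ⟨𝒜, hc, hm, h⟩ := ih
    refine ⟨insert S 𝒜, hc.insert S, ?_, fun φ hφ hA y => ?_⟩
    · rintro A (rfl | hA)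
      exacts [⟨hS, hμS⟩, hm A hA]
    · have h1 := hA S (by simp)
      have h2 := (h φ hφ (fun A hA' => hA A (by simp [hA'])) y).const_mul (-1)
      convert h1.add hφ h2 using 1
      ext x
      by_cases hx : x ∈ S <;> by_cases hxt : (x, y) ∈ t <;> simp [hx, hxt]
  | iUnion t hd htm ih =>
    choose 𝒜 hc hm h using ih
    refine ⟨⋃ i, 𝒜 i, Set.countable_iUnion hc, ?_, fun φ hφ hA y => ?_⟩
    · intro A hA
      obtain ⟨i, hi⟩ := Set.mem_iUnion.1 hA
      exact hm i A hi
    · have hsum : ∀ N x, ∑ i ∈ Finset.range N,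
          (S ∩ (fun x => (x, y)) ⁻¹' t i).indicator (1 : Ω → ℝ) x =
          (⋃ i ∈ Finset.range N, S ∩ (fun x => (x, y)) ⁻¹' t i).indicator 1 x := by
        intro N x
        rw [Finset.indicator_biUnion_apply]
        intro i _ j _ hij
        exact (((hd hij).preimage _).inter_left' _).inter_right' _
      refine PairingConverges.of_dominated hφ (b := S.indicator 1)
        (u := fun N x => ∑ i ∈ Finset.range N, (S ∩ (fun x => (x, y)) ⁻¹' t i).indicator 1 x)
        ((integrable_indicator_iff hS).2 (integrableOn_const hμS)) ?_ ?_ ?_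
      · intro N x
        rw [hsum, abs_of_nonneg (Set.indicator_nonneg (by simp) _)]
        exact Set.indicator_le_indicator_of_subset (by simp) (by simp) _
      · intro x
        simp_rw [hsum, Set.preimage_iUnion, Set.inter_iUnion]
        exact (tendsto_indicator_biUnion_finset _ _ _).comp tendsto_finset_range |>.mono_right
          (pure_le_nhds _)
      · intro N
        exact PairingConverges.sum hφ _ fun i _ =>
          h i φ hφ (fun A hA' => hA A (Set.mem_iUnion_of_mem i hA')) y

/-- Convergence of the pairings with all integrable sections of a measurable kernel follows from
convergence of the pairings with countably many sets of finite measure. -/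
lemma exists_countable_forall_pairingConverges_kernel [SigmaFinite μ] {Y : Type*}
    [MeasurableSpace Y] {F : Ω × Y → ℝ} (hF : Measurable F) :
    ∃ 𝒜 : Set (Set Ω), 𝒜.Countable ∧ (∀ A ∈ 𝒜, MeasurableSet A ∧ μ A ≠ ∞) ∧
      ∀ φ : ℕ → Ω → ℝ, IsUnitBounded φ →
        (∀ A ∈ 𝒜, PairingConverges μ φ (A.indicator 1)) →
        ∀ y, Integrable (fun x => F (x, y)) μ → PairingConverges μ φ (fun x => F (x, y)) := by
  let G := SimpleFunc.approxOn F hF Set.univ 0 (Set.mem_univ _)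
  let S := spanningSets μ
  choose 𝒜 hc hm h using fun (N : ℕ) (c : ℝ) =>
    exists_countable_forall_pairingConverges_section (μ := μ) (measurableSet_spanningSets μ N)
      (measure_spanningSets_lt_top μ N).ne ((G N).measurableSet_preimage {c})
  refine ⟨⋃ N, ⋃ c ∈ (G N).range, 𝒜 N c, ?_, ?_, fun φ hφ hA y hy => ?_⟩
  · exact Set.countable_iUnion fun N =>
      (G N).range.countable_toSet.biUnion fun c _ => hc N c
  · intro A hA
    simp only [Set.mem_iUnion] at hA
    obtain ⟨N, c, -, hA⟩ := hA
    exact hm N c A hA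
  · refine PairingConverges.of_dominated hφ (b := fun x => |F (x, y)| + |F (x, y)|)
      (u := fun N x => (S N).indicator (fun x => G N (x, y)) x) (hy.abs.add hy.abs) ?_ ?_ ?_
    · intro N x
      refine (norm_indicator_le_norm_self (fun x => G N (x, y)) x).trans ?_
      exact SimpleFunc.norm_approxOn_zero_le hF (Set.mem_univ _) (x, y) N
    · intro x
      have hx : ∀ᶠ N in atTop, x ∈ S N :=
        eventually_atTop.2 ⟨spanningSetsIndex μ x, fun N hN =>
          monotone_spanningSets μ hN (mem_spanningSetsIndex μ x)⟩
      refine (SimpleFunc.tendsto_approxOn hF (Set.mem_univ 0) (x := (x, y))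
        (by simp)).congr' ?_
      filter_upwards [hx] with N hN
      simp [hN, G]
    · intro N
      have := PairingConverges.sum hφ (G N).range fun c hcr =>
        (h N c φ hφ (fun A hA' => hA A
          (Set.mem_iUnion_of_mem N (Set.mem_biUnion hcr hA'))) y).const_mul c
      convert this using 1
      ext x
      by_cases hx : x ∈ S N
      · rw [Finset.sum_eq_single (G N (x, y))]
        · have hx' : x ∈ spanningSets μ N := hx
          simp [hx, hx', Set.indicator]
        · intro c _ hne
          simp [Set.indicator, hne.symm]
        · intro hn
          exact absurd (SimpleFunc.mem_range_self (G N) (x, y)) hn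
      · have hx' : x ∉ spanningSets μ N := hx
        simp [hx, hx', Set.indicator]

/-- Diagonal extraction: every unit bounded sequence has a subsequence whose pairings with
countably many given sets of finite measure converge. -/
lemma IsUnitBounded.exists_subseq_pairingConverges {φ : ℕ → Ω → ℝ} (hφ : IsUnitBounded φ)
    {𝒜 : Set (Set Ω)} (hc : 𝒜.Countable) (hm : ∀ A ∈ 𝒜, MeasurableSet A ∧ μ A ≠ ∞) :
    ∃ ψ : ℕ → ℕ, StrictMono ψ ∧
      ∀ A ∈ 𝒜, PairingConverges μ (fun n => φ (ψ n)) (A.indicator 1) := by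
  have := hc.to_subtype
  have hi : ∀ A ∈ 𝒜, Integrable (A.indicator (1 : Ω → ℝ)) μ := fun A hA =>
    (integrable_indicator_iff (hm A hA).1).2 (integrableOn_const (hm A hA).2)
  let C : 𝒜 → ℝ := fun A => ∫ x, A.1.indicator (1 : Ω → ℝ) x ∂μ
  let a : ℕ → 𝒜 → ℝ := fun n A => ∫ x, A.1.indicator (1 : Ω → ℝ) x * φ n x ∂μ
  have ha : ∀ n, a n ∈ Set.univ.pi fun A => Set.Icc (-C A) (C A) := fun n A _ => by
    refine abs_le.1 ?_
    refine abs_integral_le_integral_abs.trans (integral_mono_of_nonneg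
      (Eventually.of_forall fun x => abs_nonneg _) (hi A A.2) (Eventually.of_forall fun x => ?_))
    have h0 : 0 ≤ A.1.indicator (1 : Ω → ℝ) x := Set.indicator_nonneg (by simp) _
    change |A.1.indicator (1 : Ω → ℝ) x * φ n x| ≤ _
    rw [abs_mul, abs_of_nonneg h0]
    exact mul_le_of_le_one_right h0 (hφ.2 n x)
  obtain ⟨l, -, ψ, hψ, hl⟩ :=
    (isCompact_univ_pi fun A => isCompact_Icc (a := -C A) (b := C A)).tendsto_subseq ha
  exact ⟨ψ, hψ, fun A hA => ⟨hi A hA, l ⟨A, hA⟩, tendsto_pi_nhds.1 hl ⟨A, hA⟩⟩⟩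

end WeakConvergence

/-- Dominated convergence in `L^p`, for `p < ∞`. -/
lemma exists_tendsto_Lp_of_dominated {Ω : Type*} [MeasurableSpace Ω] {μ : Measure Ω} {p : ℝ≥0∞}
    [Fact (1 ≤ p)] (hp : p ≠ ∞) {F : ℕ → Lp ℝ p μ} (w : Lp ℝ p μ)
    (hb : ∀ n, ∀ᵐ x ∂μ, |F n x| ≤ w x)
    (hconv : ∀ᵐ x ∂μ, ∃ l, Tendsto (fun n => F n x) atTop (𝓝 l)) :
    ∃ G : Lp ℝ p μ, Tendsto F atTop (𝓝 G) := by
  have hp0 : p ≠ 0 := (zero_lt_one.trans_le (Fact.out : 1 ≤ p)).ne'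
  have hpr : 0 < p.toReal := ENNReal.toReal_pos hp0 hp
  obtain ⟨G, hGm, hG⟩ := exists_stronglyMeasurable_limit_of_tendsto_ae
    (fun n => Lp.aestronglyMeasurable (F n)) hconv
  have hb' := ae_all_iff.2 hb
  have hGb : ∀ᵐ x ∂μ, |G x| ≤ w x := by
    filter_upwards [hG, hb'] with x hx hbx
    exact le_of_tendsto hx.abs (Eventually.of_forall hbx)
  have hGL : MemLp G p μ := (Lp.memLp w).mono hGm.aestronglyMeasurable (by
    filter_upwards [hGb] with x hx
    exact hx.trans (le_abs_self _))
  refine ⟨hGL.toLp G, ?_⟩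
  rw [Lp.tendsto_Lp_iff_tendsto_eLpNorm F G hGL]
  simp_rw [eLpNorm_eq_lintegral_rpow_enorm_toReal hp0 hp]
  have hw : ∫⁻ x, ‖(2 : ℝ) * w x‖ₑ ^ p.toReal ∂μ ≠ ∞ :=
    (lintegral_rpow_enorm_lt_top_of_eLpNorm_lt_top hp0 hp
      ((Lp.memLp w).const_mul 2).eLpNorm_lt_top).ne
  have key : Tendsto (fun n => ∫⁻ x, ‖(⇑(F n) - G) x‖ₑ ^ p.toReal ∂μ) atTop (𝓝 0) := by
    have := tendsto_lintegral_of_dominated_convergence' (μ := μ)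
      (F := fun n x => ‖(⇑(F n) - G) x‖ₑ ^ p.toReal) (f := fun _ => 0)
      (fun x => ‖(2 : ℝ) * w x‖ₑ ^ p.toReal)
      (fun n => (((Lp.aestronglyMeasurable (F n)).sub
        hGm.aestronglyMeasurable).enorm.pow_const _)) ?_ hw ?_
    · simpa using this
    · intro n
      filter_upwards [hb n, hGb] with x h1 h2
      refine ENNReal.rpow_le_rpow ?_ hpr.le
      rw [enorm_le_iff_norm_le]
      refine ((abs_sub _ _).trans (add_le_add h1 h2)).trans ?_
      rw [← two_mul]
      exact le_abs_self _
    · filter_upwards [hG] with x hx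
      have h1 : Tendsto (fun n => (⇑(F n) - G) x) atTop (𝓝 0) := by
        simpa using hx.sub_const (G x)
      have h2 := (ENNReal.continuous_rpow_const (y := p.toReal)).continuousAt.tendsto.comp
        (continuous_enorm.continuousAt.tendsto.comp h1)
      simpa [hpr, Function.comp_def] using h2
  have := (ENNReal.continuous_rpow_const (y := 1 / p.toReal)).continuousAt.tendsto.comp key
  simpa [hpr, Function.comp_def] using this

/-- A set in a metric space is relatively compact as soon as each of its sequences has a
convergent subsequence. -/
lemma isCompact_closure_of_forall_exists_subseq {X : Type*} [PseudoMetricSpace X] {s : Set X}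
    (hs : ∀ u : ℕ → X, (∀ n, u n ∈ s) →
      ∃ a, ∃ ψ : ℕ → ℕ, StrictMono ψ ∧ Tendsto (u ∘ ψ) atTop (𝓝 a)) :
    IsCompact (closure s) := by
  refine IsSeqCompact.isCompact fun v hv => ?_
  choose u hu huv using fun n : ℕ =>
    Metric.mem_closure_iff.1 (hv n) (1 / ((n : ℝ) + 1)) Nat.one_div_pos_of_nat
  obtain ⟨a, ψ, hψ, ha⟩ := hs u hu
  refine ⟨a, mem_closure_of_tendsto ha (Eventually.of_forall fun n => hu _), ψ, hψ, ?_⟩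
  have hd : Tendsto (fun n => dist (u n) (v n)) atTop (𝓝 0) :=
    squeeze_zero (fun _ => dist_nonneg) (fun n => by rw [dist_comm]; exact (huv n).le)
      tendsto_one_div_add_atTop_nhds_zero_nat
  exact (tendsto_iff_of_dist (hd.comp hψ.tendsto_atTop)).1 ha

end Auxiliary

/-- A positive integral operator on `L^p` over a σ-finite measure space maps order
intervals to relatively compact sets. -/
theorem integralOp_image_orderInterval_relativelyCompact
    {Ω : Type*} [MeasurableSpace Ω] (μ : Measure Ω) [SigmaFinite μ]
    (p : ℝ≥0∞) [Fact (1 ≤ p)] (hp : p ≠ ∞)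
    (T : Lp ℝ p μ →L[ℝ] Lp ℝ p μ)
    (hpos : IsPositiveOp T) (hker : IsIntegralOp T)
    (f g : Lp ℝ p μ) (hfg : f ≤ g) :
    IsCompact (closure ((fun h => T h) '' Set.Icc f g)) := by
  obtain ⟨k, hkm, hk0, hk⟩ := hker
  refine isCompact_closure_of_forall_exists_subseq fun v hv => ?_
  choose h hh hTh using hv
  let u : Lp ℝ p μ := |f| + |g|
  have hu : ∀ᵐ x ∂μ, u x = |f x| + |g x| := by
    filter_upwards [Lp.coeFn_add |f| |g|, Lp.coeFn_abs f, Lp.coeFn_abs g] with x h1 h2 h3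
    rw [h1, Pi.add_apply, h2, h3]
  have hhu : ∀ n, ∀ᵐ x ∂μ, |h n x| ≤ u x := fun n => by
    filter_upwards [hu, Lp.coeFn_le _ _ |>.2 (hh n).1, Lp.coeFn_le _ _ |>.2 (hh n).2]
      with x hx h1 h2
    rw [hx, abs_le]
    constructor <;>
      linarith [neg_abs_le (f x), abs_nonneg (f x), le_abs_self (g x), abs_nonneg (g x)]
  let φ : ℕ → Ω → ℝ := fun n x => max (-1) (min 1 (h n x / u x))
  have hφ : IsUnitBounded φ := by
    refine ⟨fun n => ?_, fun n x => abs_le.2 ⟨le_max_left _ _, by simp [φ]⟩⟩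
    exact measurable_const.max (measurable_const.min
      ((Lp.stronglyMeasurable (h n)).measurable.div (Lp.stronglyMeasurable u).measurable))
  have huφ : ∀ n, ∀ᵐ x ∂μ, u x * φ n x = h n x := fun n => by
    filter_upwards [hhu n] with x hx
    rcases (abs_nonneg _ |>.trans hx).eq_or_lt with h0 | h0
    · rw [← h0] at hx ⊢
      simp [abs_nonpos_iff.1 hx]
    · have h1 : |h n x / u x| ≤ 1 := by
        rw [abs_div, abs_of_pos h0]
        exact div_le_one_of_le₀ hx h0.le
      simp only [φ]
      rw [min_eq_right (abs_le.1 h1).2, max_eq_right (abs_le.1 h1).1]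
      field_simp
  obtain ⟨𝒜, hc, hm, hconv⟩ := exists_countable_forall_pairingConverges_kernel (μ := μ)
    (hkm.mul ((Lp.stronglyMeasurable u).measurable.comp measurable_fst))
  obtain ⟨ψ, hψ, hA⟩ := hφ.exists_subseq_pairingConverges hc hm
  have hv : ∀ n, v n = T (h n) := fun n => (hTh n).symm
  have hlim := hconv (fun n => φ (ψ n)) ⟨fun n => hφ.1 _, fun n => hφ.2 _⟩ hA
  obtain ⟨G, hG⟩ := exists_tendsto_Lp_of_dominated hp (F := v ∘ ψ) (T u) (fun n => by
      simp only [Function.comp_apply, hv]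
      filter_upwards [(hk (h (ψ n))).2, (hk u).2, (hk u).1] with y h1 h2 h3
      rw [h1, h2]
      refine abs_integral_le_integral_abs.trans (integral_mono_of_nonneg
        (Eventually.of_forall fun x => abs_nonneg _) h3 ?_)
      filter_upwards [hhu (ψ n)] with x hx
      change |k x y * h (ψ n) x| ≤ k x y * u x
      rw [abs_mul, abs_of_nonneg (hk0 x y)]
      exact mul_le_mul_of_nonneg_left hx (hk0 x y)) (by
      filter_upwards [ae_all_iff.2 fun n => (hk (h n)).2, (hk u).1] with y h1 h2
      obtain ⟨-, l, hl⟩ := hlim y h2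
      refine ⟨l, hl.congr fun n => ?_⟩
      simp only [Function.comp_apply, hv]
      rw [h1]
      refine integral_congr_ae ?_
      filter_upwards [huφ (ψ n)] with x hx
      simp only [Pi.mul_apply, Function.comp_apply, Function.uncurry_apply_pair]
      rw [mul_assoc, hx])
  exact ⟨G, ψ, hψ, hG⟩
end
end

section
/- Let p ∈ [1, ∞), let I be a nonempty set, and let S : ℓ^p(I) → ℓ^p(I) be a surjective linear isometry such that both S and S⁻¹ are positive (i.e., S f ≥ 0 and S⁻¹ f ≥ 0 whenever f ≥ 0). Then for every i ∈ I there exists j ∈ I such that S e_i = e_j, where e_i denotes the canonical unit vector supported at i. -/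
open scoped ENNReal NNReal

noncomputable section

/-- A surjective positive linear isometry of `ℓ^p(I)` with positive inverse maps
canonical unit vectors to canonical unit vectors. -/
theorem positive_isometry_maps_unit_vectors
    (p : ℝ≥0∞) [Fact (1 ≤ p)] (hp : p ≠ ∞)
    (I : Type*) [Nonempty I] [DecidableEq I]
    (S : lp (fun _ : I => ℝ) p ≃ₗᵢ[ℝ] lp (fun _ : I => ℝ) p)
    (hS : ∀ f : lp (fun _ : I => ℝ) p, (∀ i, 0 ≤ f i) → ∀ i, 0 ≤ S f i)
    (hS' : ∀ f : lp (fun _ : I => ℝ) p, (∀ i, 0 ≤ f i) → ∀ i, 0 ≤ S.symm f i) :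
    ∀ i : I, ∃ j : I, S (lp.single p i 1) = lp.single p j 1 := by
  intro i
  have hp0 : 0 < p := zero_lt_one.trans_le Fact.out
  have single_nonneg : ∀ k l : I, 0 ≤ lp.single (E := fun _ : I => ℝ) p k 1 l := by
    intro k l
    rw [lp.single_apply, Pi.single_apply]
    split_ifs <;> norm_num
  have hg := hS _ (single_nonneg i)
  obtain ⟨j, hj⟩ : ∃ j, S (lp.single p i 1) j ≠ 0 := by
    by_contra! h
    have h0 : S (lp.single p i 1) = 0 := lp.ext (funext h)
    have hn := S.norm_map (lp.single p i 1)
    rw [h0, lp.norm_single hp0] at hn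
    simp at hn
  set c := S (lp.single p i 1) j with hc
  have hc0 : 0 < c := lt_of_le_of_ne (hg j) hj.symm
  have hdom : ∀ k, c * S.symm (lp.single p j 1) k ≤
      lp.single (E := fun _ : I => ℝ) p i 1 k := by
    intro k
    have h := hS' (S (lp.single p i 1) - c • lp.single p j 1) (fun l => by
      change 0 ≤ S (lp.single p i 1) l - c * lp.single (E := fun _ : I => ℝ) p j 1 l
      rcases eq_or_ne l j with rfl | hl
      · simp [hc]
      · simpa [hl] using hg l) k
    rw [map_sub, map_smul, S.symm_apply_apply] at h
    exact sub_nonneg.mp h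
  have hpos := hS' _ (single_nonneg j)
  obtain ⟨d, hd⟩ : ∃ d, d = S.symm (lp.single p j 1) i := ⟨_, rfl⟩
  have hsymm : S.symm (lp.single p j 1) = lp.single p i d := by
    refine lp.ext (funext fun k => ?_)
    rcases eq_or_ne k i with rfl | hk
    · rw [lp.single_apply_self, hd]
    · have h := hdom k
      rw [lp.single_apply_ne _ _ _ hk] at h ⊢
      exact le_antisymm (nonpos_of_mul_nonpos_right h hc0) (hpos k)
  have hd1 : d = 1 := by
    have hn := S.symm.norm_map (lp.single p j 1)
    rw [hsymm, lp.norm_single hp0, lp.norm_single hp0, norm_one, Real.norm_eq_abs,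
      abs_of_nonneg (hd ▸ hpos i)] at hn
    exact hn
  refine ⟨j, ?_⟩
  rw [← hd1, ← hsymm, S.apply_symm_apply, hd1]
end
end

section
/- Let p ∈ [1, ∞), let I be a set, and let (S_t)_{t ∈ ℝ} be a family of surjective linear isometries of ℓ^p(I) such that S_0 = Id, S_{s+t} = S_s S_t for all s, t ∈ ℝ, each S_t and each S_t⁻¹ is positive (i.e., maps nonnegative elements to nonnegative elements), and t ↦ S_t f is continuous from ℝ to ℓ^p(I) for every f ∈ ℓ^p(I). Then S_t = Id for every t ∈ ℝ. -/
open scoped ENNReal NNReal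

noncomputable section

open Classical in
/-- A positive linear isometric equivalence of `ℓ^p(I)` with positive inverse maps each standard
unit vector `e_i` to `e_j`, for any `j` in the support of its image. -/
theorem lp_map_single_eq_single_of_apply_ne_zero {p : ℝ≥0∞} [Fact (1 ≤ p)] {I : Type*}
    (T : lp (fun _ : I => ℝ) p ≃ₗᵢ[ℝ] lp (fun _ : I => ℝ) p)
    (hT : ∀ f : lp (fun _ : I => ℝ) p, (∀ i, 0 ≤ f i) → ∀ i, 0 ≤ T f i)
    (hT' : ∀ f : lp (fun _ : I => ℝ) p, (∀ i, 0 ≤ f i) → ∀ i, 0 ≤ T.symm f i)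
    {i j : I} (hij : T (lp.single p i (1 : ℝ)) j ≠ 0) :
    T (lp.single p i (1 : ℝ)) = lp.single p j (1 : ℝ) := by
  have hp : 0 < p := zero_lt_one.trans_le Fact.out
  have single_nonneg {k : I} {c : ℝ} (hc : 0 ≤ c) :
      ∀ l, 0 ≤ (lp.single p k c : lp (fun _ : I => ℝ) p) l := fun l =>
    (Pi.single_nonneg.2 hc : (0 : I → ℝ) ≤ Pi.single k c) l
  set g := T (lp.single p i (1 : ℝ)) with hg
  have hg0 : ∀ k, 0 ≤ g k := hT _ (single_nonneg zero_le_one)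
  set h := T.symm (lp.single p j (g j)) with hh
  have hh0 : ∀ k, 0 ≤ h k := hT' _ (single_nonneg (hg0 j))
  have hle : ∀ k, h k ≤ (lp.single p i (1 : ℝ) : lp (fun _ : I => ℝ) p) k := by
    intro k
    have hsub := hT' (g - lp.single p j (g j)) (fun l => by
      rw [lp.coeFn_sub, Pi.sub_apply]
      rcases eq_or_ne l j with rfl | hl
      · simp
      · simpa [hl] using hg0 l) k
    rw [map_sub, hg, T.symm_apply_apply, ← hg, ← hh, lp.coeFn_sub, Pi.sub_apply] at hsub
    linarith
  have hsingle : h = h i • lp.single p i (1 : ℝ) := by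
    ext k
    rcases eq_or_ne k i with rfl | hk
    · simp
    · have hk' := hle k
      rw [lp.single_apply_ne p i _ hk] at hk'
      simpa [hk] using le_antisymm hk' (hh0 k)
  have hgj : lp.single p j (g j) = h i • g := by
    rw [hg, ← map_smul, ← hsingle, hh, T.apply_symm_apply]
  have hi : h i = 1 := by
    have hj : g j = h i * g j := by
      simpa using congrArg (fun f : lp (fun _ : I => ℝ) p => f j) hgj
    exact mul_right_cancel₀ hij (by rw [← hj, one_mul])
  rw [hi, one_smul] at hgj
  have hnorm : ‖g‖ = 1 := by
    rw [hg, T.norm_map, lp.norm_single hp, norm_one]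
  rw [← hgj, lp.norm_single hp, Real.norm_of_nonneg (hg0 j)] at hnorm
  rw [← hgj, hnorm]

/-- A strongly continuous group of positive (with positive inverses) surjective linear
isometries of `ℓ^p(I)` is trivial. -/
theorem positive_isometry_group_on_lp_trivial
    (p : ℝ≥0∞) [Fact (1 ≤ p)] (hp : p ≠ ∞)
    (I : Type*)
    (S : ℝ → (lp (fun _ : I => ℝ) p ≃ₗᵢ[ℝ] lp (fun _ : I => ℝ) p))
    (hS0 : ∀ f, S 0 f = f)
    (hgrp : ∀ s t : ℝ, ∀ f, S (s + t) f = S s (S t f))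
    (hpos : ∀ t : ℝ, ∀ f : lp (fun _ : I => ℝ) p, (∀ i, 0 ≤ f i) → ∀ i, 0 ≤ S t f i)
    (hpos' : ∀ t : ℝ, ∀ f : lp (fun _ : I => ℝ) p,
      (∀ i, 0 ≤ f i) → ∀ i, 0 ≤ (S t).symm f i)
    (hcont : ∀ f : lp (fun _ : I => ℝ) p, Continuous fun t : ℝ => S t f) :
    ∀ t : ℝ, ∀ f, S t f = f := by
  classical
  have hsingle (t : ℝ) (i : I) : S t (lp.single p i (1 : ℝ)) = lp.single p i (1 : ℝ) := by
    apply lp_map_single_eq_single_of_apply_ne_zero (S t) (hpos t) (hpos' t)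
    have hc : Continuous fun s : ℝ => S s (lp.single p i (1 : ℝ)) i :=
      (lp.evalCLM ℝ (fun _ : I => ℝ) p i).continuous.comp (hcont _)
    have hmem : ∀ s : ℝ, S s (lp.single p i (1 : ℝ)) i ∈ ({0, 1} : Set ℝ) := by
      intro s
      by_cases hs : S s (lp.single p i (1 : ℝ)) i = 0
      · exact Or.inl hs
      · right
        rw [lp_map_single_eq_single_of_apply_ne_zero (S s) (hpos s) (hpos' s) hs]
        exact lp.single_apply_self p i _
    have heq := isPreconnected_univ.constant_of_mapsTo (Set.toFinite ({0, 1} : Set ℝ)).isDiscrete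
      hc.continuousOn (fun s _ => hmem s) (Set.mem_univ t) (Set.mem_univ 0)
    rw [heq, hS0, lp.single_apply_self]
    exact one_ne_zero
  intro t f
  have hS : ((S t).toContinuousLinearEquiv : lp (fun _ : I => ℝ) p →L[ℝ] lp (fun _ : I => ℝ) p) =
      ContinuousLinearMap.id ℝ _ := by
    refine lp.ext_continuousLinearMap hp fun i => ?_
    ext1
    exact hsingle t i
  exact DFunLike.congr_fun hS f
end
end

section
/- Let (Ω, μ) be a σ-finite measure space, let p ∈ [1, ∞), and let T be a positive and contractive bounded linear operator on L^p(Ω, μ; ℝ). If g ∈ L^p satisfies 0 ≤ g ≤ T g, then T g = g. -/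
open MeasureTheory Filter
open scoped ENNReal NNReal

noncomputable section

/-- For `p < ∞` the norm of `L^p` is strictly monotone on the positive cone. -/
theorem Lp_eq_of_nonneg_of_le_of_norm_le {Ω : Type*} [MeasurableSpace Ω] {μ : Measure Ω}
    {p : ℝ≥0∞} (hp0 : p ≠ 0) (hp : p ≠ ∞) {f h : Lp ℝ p μ} (hf : 0 ≤ f) (hfh : f ≤ h)
    (hnorm : ‖h‖ ≤ ‖f‖) : f = h := by
  have hpr : 0 < p.toReal := ENNReal.toReal_pos hp0 hp
  have hf0 : 0 ≤ᵐ[μ] (f : Ω → ℝ) := (Lp.coeFn_nonneg f).2 hf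
  have hle : (f : Ω → ℝ) ≤ᵐ[μ] h := (Lp.coeFn_le f h).2 hfh
  have hpow : (fun x => ‖f x‖ₑ ^ p.toReal) ≤ᵐ[μ] fun x => ‖h x‖ₑ ^ p.toReal := by
    filter_upwards [hf0, hle] with x hx0 hx
    rw [Real.enorm_of_nonneg hx0, Real.enorm_of_nonneg (hx0.trans hx)]
    gcongr
  have hint : ∫⁻ x, ‖h x‖ₑ ^ p.toReal ∂μ ≤ ∫⁻ x, ‖f x‖ₑ ^ p.toReal ∂μ := by
    rw [Lp.norm_def, Lp.norm_def,
      ENNReal.toReal_le_toReal (Lp.eLpNorm_ne_top h) (Lp.eLpNorm_ne_top f),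
      eLpNorm_eq_lintegral_rpow_enorm_toReal hp0 hp,
      eLpNorm_eq_lintegral_rpow_enorm_toReal hp0 hp] at hnorm
    exact (ENNReal.rpow_le_rpow_iff (one_div_pos.2 hpr)).1 hnorm
  have hfin : ∫⁻ x, ‖f x‖ₑ ^ p.toReal ∂μ ≠ ∞ :=
    (lintegral_rpow_enorm_lt_top_of_eLpNorm_lt_top hp0 hp (Lp.eLpNorm_lt_top f)).ne
  have heq := ae_eq_of_ae_le_of_lintegral_le hpow hfin
    ((Lp.aestronglyMeasurable h).enorm.pow_const _) hint
  apply Lp.ext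
  filter_upwards [heq, hf0, hle] with x hx hx0 hxle
  have henorm := ENNReal.rpow_left_injective hpr.ne' hx
  rw [Real.enorm_of_nonneg hx0, Real.enorm_of_nonneg (hx0.trans hxle)] at henorm
  exact (ENNReal.ofReal_eq_ofReal_iff hx0 (hx0.trans hxle)).1 henorm

/-- For a positive contractive operator on `L^p`, every nonnegative super-fixed point
is a fixed point. -/
theorem superFixedPoint_is_fixedPoint
    {Ω : Type*} [MeasurableSpace Ω] (μ : Measure Ω) [SigmaFinite μ]
    (p : ℝ≥0∞) [Fact (1 ≤ p)] (hp : p ≠ ∞)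
    (T : Lp ℝ p μ →L[ℝ] Lp ℝ p μ)
    (hpos : IsPositiveOp T)
    (hcontr : ∀ f : Lp ℝ p μ, ‖T f‖ ≤ ‖f‖)
    (g : Lp ℝ p μ) (hg0 : 0 ≤ g) (hgT : g ≤ T g) :
    T g = g := by
  exact (Lp_eq_of_nonneg_of_le_of_norm_le (zero_lt_one.trans_le Fact.out).ne' hp hg0 hgT
    (hcontr g)).symm
end
end
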